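/- Let H ∈ A and A' := A \ {H}. Assume χ(A;t) = ∏_{i=1}^ℓ (t − d_i) and that d := |A'| − |A^H| satisfies d > d_i for all i. Then A is free if and only if A' is strictly plus-one generated with POexp(A') = (d_1,…,d_ℓ). In this case exp(A) = POexp(A') and the level of A' is d. -/

import Mathlib

open MvPolynomial

noncomputable section

attribute [local instance] Classical.propDecidable

namespace ArrPOG

variable (K : Type) [Field K] (ℓ : ℕ)

/-- A polynomial vector field on `K^ℓ`: `θ = Σ θᵢ ∂/∂xᵢ`, identified with its
coefficient vector `(θ₁,…,θ_ℓ)` in `S = K[x₁,…,x_ℓ]`. -/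
abbrev Deriv : Type := Fin ℓ → MvPolynomial (Fin ℓ) K

variable {K ℓ}

/-- The linear polynomial `α_H ∈ S` associated to a linear form `φ ∈ V*`. -/
def linPoly (φ : Module.Dual K (Fin ℓ → K)) : MvPolynomial (Fin ℓ) K :=
  ∑ i, MvPolynomial.C (φ (Pi.single i 1)) * MvPolynomial.X i

/-- `θ(α)` for a derivation `θ` and the linear form `α` given by `φ ∈ V*`. -/
def applyLin (θ : Deriv K ℓ) (φ : Module.Dual K (Fin ℓ → K)) : MvPolynomial (Fin ℓ) K :=
  ∑ i, MvPolynomial.C (φ (Pi.single i 1)) * θ i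

/-- An arrangement: a finite set of hyperplanes (kernels of nonzero linear forms). -/
def IsArrangement (A : Finset (Submodule K (Fin ℓ → K))) : Prop :=
  ∀ H ∈ A, ∃ φ : Module.Dual K (Fin ℓ → K), φ ≠ 0 ∧ LinearMap.ker φ = H

/-- Essential: the common intersection of all members is `0`. -/
def Essential (A : Finset (Submodule K (Fin ℓ → K))) : Prop :=
  A.inf id = ⊥

/-- Membership in the logarithmic derivation module `D(A)`:
`θ(α_H) ∈ S·α_H` for every `H ∈ A`. -/
def InD (A : Finset (Submodule K (Fin ℓ → K))) (θ : Deriv K ℓ) : Prop :=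
  ∀ H ∈ A, ∀ φ : Module.Dual K (Fin ℓ → K), LinearMap.ker φ = H → linPoly φ ∣ applyLin θ φ

/-- A derivation is homogeneous of degree `n` if all its coefficients are. -/
def HomogDeriv (θ : Deriv K ℓ) (n : ℕ) : Prop := ∀ i, (θ i).IsHomogeneous n

/-- `θ₁,…,θₙ` generate `D(A)` as an `S`-module. -/
def GeneratesD {n : ℕ} (A : Finset (Submodule K (Fin ℓ → K))) (θ : Fin n → Deriv K ℓ) : Prop :=
  (∀ i, InD A (θ i)) ∧
    ∀ η, InD A η → ∃ c : Fin n → MvPolynomial (Fin ℓ) K, η = ∑ i, c i • θ i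

/-- `S`-linear independence of a family of derivations. -/
def IndepD {n : ℕ} (θ : Fin n → Deriv K ℓ) : Prop :=
  ∀ c : Fin n → MvPolynomial (Fin ℓ) K, (∑ i, c i • θ i) = 0 → ∀ i, c i = 0

/-- `A` is free with exponents `e`: `D(A)` has a homogeneous basis of degrees `e i`. -/
def IsFreeExp (A : Finset (Submodule K (Fin ℓ → K))) (e : Fin ℓ → ℕ) : Prop :=
  ∃ θ : Fin ℓ → Deriv K ℓ, (∀ i, HomogDeriv (θ i) (e i)) ∧ GeneratesD A θ ∧ IndepD θ

/-- `A` is free. -/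
def IsFree (A : Finset (Submodule K (Fin ℓ → K))) : Prop := ∃ e, IsFreeExp A e

/-- `A` is plus-one generated with exponents `e`, level `lev`, realized by the minimal
homogeneous generators `θ₁,…,θ_ℓ, φ` whose unique syzygy is `Σ fᵢ•θᵢ + α•φ = 0`:
this encodes the minimal free resolution
`0 → S[-lev-1] → S[-lev] ⊕ (⊕ S[-eᵢ]) → D(A) → 0`. -/
def IsPOGWith (A : Finset (Submodule K (Fin ℓ → K))) (e : Fin ℓ → ℕ) (lev : ℕ)
    (θ : Fin ℓ → Deriv K ℓ) (φ : Deriv K ℓ)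
    (f : Fin ℓ → MvPolynomial (Fin ℓ) K) (α : MvPolynomial (Fin ℓ) K) : Prop :=
  (∀ i, InD A (θ i)) ∧ InD A φ ∧
  (∀ i, HomogDeriv (θ i) (e i)) ∧ HomogDeriv φ lev ∧
  (∀ η, InD A η → ∃ (c : Fin ℓ → MvPolynomial (Fin ℓ) K) (g : MvPolynomial (Fin ℓ) K),
      η = (∑ i, c i • θ i) + g • φ) ∧
  α.IsHomogeneous 1 ∧
  (∀ i, (f i).IsHomogeneous (lev + 1 - e i)) ∧
  (∀ i, MvPolynomial.constantCoeff (f i) = 0) ∧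
  ((∑ i, f i • θ i) + α • φ = 0) ∧
  (¬ (α = 0 ∧ ∀ i, f i = 0)) ∧
  (∀ (g : Fin ℓ → MvPolynomial (Fin ℓ) K) (h : MvPolynomial (Fin ℓ) K),
      ((∑ i, g i • θ i) + h • φ = 0) →
      ∃ q : MvPolynomial (Fin ℓ) K, (∀ i, g i = q * f i) ∧ h = q * α)

/-- Plus-one generated with exponents `e` and level `lev`. -/
def IsPOG (A : Finset (Submodule K (Fin ℓ → K))) (e : Fin ℓ → ℕ) (lev : ℕ) : Prop :=
  ∃ θ φ f α, IsPOGWith A e lev θ φ f α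

/-- Strictly plus-one generated: the level coefficient `α` is nonzero. -/
def IsSPOG (A : Finset (Submodule K (Fin ℓ → K))) (e : Fin ℓ → ℕ) (lev : ℕ) : Prop :=
  ∃ θ φ f α, IsPOGWith A e lev θ φ f α ∧ α ≠ 0

/-- The restriction `A^H = {L ⊓ H | L ∈ A \ {H}}`. -/
def restrict (A : Finset (Submodule K (Fin ℓ → K))) (H : Submodule K (Fin ℓ → K)) :
    Finset (Submodule K (Fin ℓ → K)) :=
  (A.erase H).image (fun L => L ⊓ H)

/-- The localization `A_X = {L ∈ A | X ⊆ L}`. -/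
def localize (A : Finset (Submodule K (Fin ℓ → K))) (X : Submodule K (Fin ℓ → K)) :
    Finset (Submodule K (Fin ℓ → K)) :=
  A.filter (fun L => X ≤ L)

/-- The intersection lattice of `A`, inside the ambient space `T`. -/
def latticeOf (T : Submodule K (Fin ℓ → K)) (A : Finset (Submodule K (Fin ℓ → K))) :
    Finset (Submodule K (Fin ℓ → K)) :=
  A.powerset.image (fun B => T ⊓ B.inf id)

/-- The Möbius function of the poset `L` (intersection lattice with top `T`). -/
def mob (T : Submodule K (Fin ℓ → K)) (L : Finset (Submodule K (Fin ℓ → K)))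
    (X : Submodule K (Fin ℓ → K)) : ℤ :=
  if X = T then 1
  else - ∑ Y ∈ (L.filter fun Z => X < Z).attach, mob T L Y.1
termination_by (L.filter fun Z => X < Z).card
decreasing_by
  obtain ⟨Y, hY⟩ := Y
  simp only [Finset.mem_filter] at hY
  apply Finset.card_lt_card
  rw [Finset.ssubset_def]
  constructor
  · intro Z hZ
    simp only [Finset.mem_filter] at hZ ⊢
    exact ⟨hZ.1, lt_trans hY.2 hZ.2⟩
  · intro hsub
    have h2 := hsub (Finset.mem_filter.mpr ⟨hY.1, hY.2⟩)
    simp only [Finset.mem_filter] at h2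
    exact lt_irrefl Y h2.2

/-- The characteristic polynomial `χ(A;t) = Σ_{X ∈ L(A)} μ(X) t^{dim X}`
of an arrangement inside the ambient space `T`. -/
def charPoly (T : Submodule K (Fin ℓ → K)) (A : Finset (Submodule K (Fin ℓ → K))) :
    Polynomial ℤ :=
  ∑ X ∈ latticeOf T A,
    Polynomial.C (mob T (latticeOf T A) X) * Polynomial.X ^ (Module.finrank K X)

/-- The Betti number `b_i(A)`: `χ(A;t) = Σ (-1)^i b_i(A) t^{ℓ-i}`. -/
def bNum (A : Finset (Submodule K (Fin ℓ → K))) (i : ℕ) : ℤ :=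
  (-1) ^ i * (charPoly (⊤ : Submodule K (Fin ℓ → K)) A).coeff (ℓ - i)

/-- Evaluation of the Poincaré polynomial `π(A;t) = Σ μ(X) (-t)^{codim X}` at `t : ℚ`. -/
def poincareEval (A : Finset (Submodule K (Fin ℓ → K))) (t : ℚ) : ℚ :=
  ∑ X ∈ latticeOf ⊤ A,
    (mob (⊤ : Submodule K (Fin ℓ → K)) (latticeOf ⊤ A) X : ℚ) *
      (-t) ^ (ℓ - Module.finrank K X)

/-- The Euler derivation `θ_E = Σ xᵢ ∂/∂xᵢ`. -/
def eulerD : Deriv K ℓ := fun i => MvPolynomial.X i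

/-- `A` is locally free: `A_X` is free for every `X ∈ L(A)` other than `∩_{H∈A} H`. -/
def LocallyFree (A : Finset (Submodule K (Fin ℓ → K))) : Prop :=
  ∀ X ∈ latticeOf ⊤ A, X ≠ A.inf id → IsFree (localize A X)

/-- Transport a finite set of subspaces contained in `T` to `K^m` along a linear
isomorphism `T ≃ K^m`. -/
def transport {m : ℕ} (T : Submodule K (Fin ℓ → K)) (eqv : T ≃ₗ[K] (Fin m → K))
    (A : Finset (Submodule K (Fin ℓ → K))) : Finset (Submodule K (Fin m → K)) :=
  A.image fun L => (L.comap T.subtype).map eqv.toLinearMap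

/-- An arrangement inside the subspace `T` is free with exponents `e`, i.e. it is free
after identifying `T` with a coordinate space. -/
def RestrFreeExp {m : ℕ} (T : Submodule K (Fin ℓ → K))
    (A : Finset (Submodule K (Fin ℓ → K))) (e : Fin m → ℕ) : Prop :=
  ∃ eqv : T ≃ₗ[K] (Fin m → K), IsFreeExp (transport T eqv A) e

/-- The multiset of exponents. -/
def expMS {n : ℕ} (e : Fin n → ℕ) : Multiset ℕ := Finset.univ.val.map e

/-- `D(A)` has projective dimension at most 1: some finite generating set has a free
(possibly zero) syzygy module, i.e. there is a free resolution
`0 → S^m → S^n → D(A) → 0`. -/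
def PdimLEOne (A : Finset (Submodule K (Fin ℓ → K))) : Prop :=
  ∃ (n m : ℕ) (θ : Fin n → Deriv K ℓ) (r : Fin m → Fin n → MvPolynomial (Fin ℓ) K),
    GeneratesD A θ ∧
    (∀ j, (∑ i, r j i • θ i) = 0) ∧
    (∀ c : Fin n → MvPolynomial (Fin ℓ) K, (∑ i, c i • θ i) = 0 →
      ∃ q : Fin m → MvPolynomial (Fin ℓ) K, ∀ i, c i = ∑ j, q j * r j i) ∧
    (∀ q : Fin m → MvPolynomial (Fin ℓ) K, (∀ i, (∑ j, q j * r j i) = 0) → ∀ j, q j = 0)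

/-- `A` has a free filtration `∅ = A₀ ⊂ A₁ ⊂ ⋯ ⊂ A_n = A`, `|A_i| = i`, each `A_i` free. -/
def HasFreeFiltration (A : Finset (Submodule K (Fin ℓ → K))) : Prop :=
  ∃ c : ℕ → Finset (Submodule K (Fin ℓ → K)),
    c A.card = A ∧ (∀ i ≤ A.card, (c i).card = i ∧ IsFree (c i)) ∧
    ∀ i < A.card, c i ⊆ c (i + 1)

/-- The intersection lattices of `A` and `B` are isomorphic: there is a bijection of
hyperplanes preserving the rank of every subset (equivalently, a lattice isomorphism). -/
def LatticeEquiv (A B : Finset (Submodule K (Fin ℓ → K))) : Prop :=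
  ∃ σ : Submodule K (Fin ℓ → K) → Submodule K (Fin ℓ → K),
    Set.BijOn σ ↑A ↑B ∧
    ∀ T ⊆ A, Module.finrank K ((T.inf id : Submodule K (Fin ℓ → K))) =
      Module.finrank K (((T.image σ).inf id : Submodule K (Fin ℓ → K)))


end ArrPOG

end

section

namespace ArrAux
open MvPolynomial

variable {k : Type*} [Field k] {ℓ : ℕ}

/-- linear polynomial with coefficient vector `a` -/
noncomputable def lin (a : Fin ℓ → k) : MvPolynomial (Fin ℓ) k := ∑ i, C (a i) * X i

/-- derivation applied to the linear form -/
noncomputable def app (a : Fin ℓ → k) (θ : Fin ℓ → MvPolynomial (Fin ℓ) k) :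
    MvPolynomial (Fin ℓ) k := ∑ i, C (a i) * θ i

theorem coeff_lin (a : Fin ℓ → k) (i : Fin ℓ) : (lin a).coeff (Finsupp.single i 1) = a i := by
  classical
  unfold lin
  rw [coeff_sum, Finset.sum_eq_single i]
  · simp
  · intro j _ hji
    rw [coeff_C_mul, coeff_X, if_neg, mul_zero]
    rwa [Finsupp.single_left_inj one_ne_zero]
  · simp

theorem lin_homog (a : Fin ℓ → k) : (lin a).IsHomogeneous 1 :=
  IsHomogeneous.sum _ _ _ fun i _ => isHomogeneous_C_mul_X _ _

theorem lin_inj {a b : Fin ℓ → k} (h : lin a = lin b) : a = b := by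
  funext i; rw [← coeff_lin a, h, coeff_lin]

theorem lin_zero : lin (0 : Fin ℓ → k) = 0 := by simp [lin]

theorem lin_smul (c : k) (a : Fin ℓ → k) : lin (c • a) = C c * lin a := by
  simp [lin, Finset.mul_sum, mul_assoc]

theorem lin_sub (a b : Fin ℓ → k) : lin (a - b) = lin a - lin b := by
  simp [lin, sub_mul, Finset.sum_sub_distrib]

theorem app_sub' (a b : Fin ℓ → k) (θ) : app (a - b) θ = app a θ - app b θ := by
  simp [app, sub_mul, Finset.sum_sub_distrib]

theorem app_smul' (c : k) (a : Fin ℓ → k) (θ) : app (c • a) θ = C c * app a θ := by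
  simp [app, Finset.mul_sum, mul_assoc]

theorem app_smul (a : Fin ℓ → k) (p : MvPolynomial (Fin ℓ) k) (θ) :
    app a (p • θ) = p * app a θ := by
  simp only [app, Finset.mul_sum, Pi.smul_apply, smul_eq_mul]
  exact Finset.sum_congr rfl fun i _ => by ring

theorem app_add (a : Fin ℓ → k) (θ η) : app a (θ + η) = app a θ + app a η := by
  simp [app, mul_add, Finset.sum_add_distrib]

theorem app_sub (a : Fin ℓ → k) (θ η) : app a (θ - η) = app a θ - app a η := by
  simp [app, mul_sub, Finset.sum_sub_distrib]

theorem app_zero (a : Fin ℓ → k) : app a 0 = 0 := by simp [app]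

theorem app_sum {ι : Type*} (s : Finset ι) (a : Fin ℓ → k)
    (θ : ι → Fin ℓ → MvPolynomial (Fin ℓ) k) :
    app a (∑ i ∈ s, θ i) = ∑ i ∈ s, app a (θ i) := by
  classical
  induction s using Finset.induction_on with
  | empty => simp [app_zero]
  | insert i s hi ih => rw [Finset.sum_insert hi, Finset.sum_insert hi, app_add, ih]

theorem lin_ne_zero {a : Fin ℓ → k} (ha : a ≠ 0) : lin a ≠ 0 := by
  intro h; exact ha (lin_inj (h.trans lin_zero.symm))

theorem lin_deg {a : Fin ℓ → k} (ha : a ≠ 0) : (lin a).totalDegree = 1 :=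
  (lin_homog a).totalDegree (lin_ne_zero ha)

theorem lin_prime {a : Fin ℓ → k} (ha : a ≠ 0) : Prime (lin a) := by
  apply Irreducible.prime
  apply irreducible_of_totalDegree_eq_one (lin_deg ha)
  intro x hx
  rw [isUnit_iff_ne_zero]
  rintro rfl
  exact lin_ne_zero ha (by ext i; simpa using hx i)

/-- divisibility of linear forms forces proportionality -/
theorem lin_dvd {a b : Fin ℓ → k} (hb : b ≠ 0) (h : lin a ∣ lin b) :
    ∃ c : k, c ≠ 0 ∧ b = c • a := by
  obtain ⟨p, hp⟩ := h
  have hb' := lin_ne_zero hb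
  have ha : lin a ≠ 0 := by rintro h; rw [hp, h, zero_mul] at hb'; exact hb' rfl
  have hp0 : p ≠ 0 := by rintro rfl; rw [hp, mul_zero] at hb'; exact hb' rfl
  have ha' : a ≠ 0 := by rintro rfl; exact ha lin_zero
  have h1 : (lin b).totalDegree = _ := congrArg totalDegree hp
  rw [totalDegree_mul_of_isDomain ha hp0, lin_deg ha', lin_deg hb] at h1
  have h2 := (totalDegree_eq_zero_iff_eq_C (p := p)).1 (by omega)
  refine ⟨p.coeff 0, ?_, ?_⟩
  · intro h; rw [h] at h2; exact hp0 (by simpa using h2)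
  · apply lin_inj; rw [lin_smul, hp, mul_comm, ← h2]

theorem lin_relPrime {a b : Fin ℓ → k} (ha : a ≠ 0) (hb : b ≠ 0)
    (h : ∀ c : k, b ≠ c • a) : IsRelPrime (lin a) (lin b) := by
  rw [(lin_prime ha).irreducible.isRelPrime_iff_not_dvd]
  intro hd
  obtain ⟨c, _, hc⟩ := lin_dvd hb hd
  exact h c hc

/-- if all rows are logarithmic along `a` then `lin a` divides the determinant -/
theorem lin_dvd_det {a : Fin ℓ → k} (ha : a ≠ 0)
    (M : Matrix (Fin ℓ) (Fin ℓ) (MvPolynomial (Fin ℓ) k))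
    (h : ∀ j, lin a ∣ app a (M j)) : lin a ∣ M.det := by
  obtain ⟨i, hi⟩ : ∃ i, a i ≠ 0 := by by_contra! h; exact ha (funext h)
  choose g hg using h
  have h1 : M.mulVec (fun i => C (a i)) = lin a • g := by
    funext j
    simp only [Matrix.mulVec, dotProduct, Pi.smul_apply, smul_eq_mul, ← hg j, app]
    exact Finset.sum_congr rfl fun i _ => mul_comm _ _
  have h2 : M.det * C (a i) = lin a * (M.adjugate.mulVec g) i := by
    have := congrArg (fun v => M.adjugate.mulVec v i) h1
    simp only [Matrix.mulVec_mulVec, Matrix.adjugate_mul, Matrix.smul_mulVec, Matrix.one_mulVec,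
      Matrix.mulVec_smul, Pi.smul_apply, smul_eq_mul] at this
    exact this
  have h3 : lin a ∣ M.det * C (a i) := ⟨_, h2⟩
  refine ((lin_prime ha).dvd_or_dvd h3).resolve_right fun h4 => ?_
  have : IsUnit (C (a i) : MvPolynomial (Fin ℓ) k) := (isUnit_iff_ne_zero.2 hi).map C
  exact (lin_prime ha).not_isUnit (isUnit_of_dvd_unit h4 this)

section family
variable {ι : Type*} (s : Finset ι) (a : ι → Fin ℓ → k)

/-- the defining polynomial -/
noncomputable def Qp : MvPolynomial (Fin ℓ) k := ∏ i ∈ s, lin (a i)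

/-- pairwise non-proportional, nonzero -/
def NonProp : Prop := (∀ i ∈ s, a i ≠ 0) ∧ ∀ i ∈ s, ∀ j ∈ s, i ≠ j → ∀ c : k, a j ≠ c • a i

/-- logarithmic derivations -/
def Log (θ : Fin ℓ → MvPolynomial (Fin ℓ) k) : Prop := ∀ i ∈ s, lin (a i) ∣ app (a i) θ

variable {s a}

theorem Log.add {θ η} (h : Log s a θ) (h' : Log s a η) : Log s a (θ + η) := fun i hi => by
  rw [app_add]; exact dvd_add (h i hi) (h' i hi)

theorem Log.sub {θ η} (h : Log s a θ) (h' : Log s a η) : Log s a (θ - η) := fun i hi => by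
  rw [app_sub]; exact dvd_sub (h i hi) (h' i hi)

theorem Log.smul {θ} (p : MvPolynomial (Fin ℓ) k) (h : Log s a θ) : Log s a (p • θ) := fun i hi => by
  rw [app_smul]; exact Dvd.dvd.mul_left (h i hi) _

theorem Log.sum {κ : Type*} {t : Finset κ} {θ : κ → _} (h : ∀ j ∈ t, Log s a (θ j)) :
    Log s a (∑ j ∈ t, θ j) := fun i hi => by
  rw [app_sum]; exact Finset.dvd_sum fun j hj => h j hj i hi

theorem Qp_ne_zero (h : NonProp s a) : Qp s a ≠ 0 :=
  Finset.prod_ne_zero_iff.2 fun i hi => lin_ne_zero (h.1 i hi)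

theorem Qp_homog : (Qp s a).IsHomogeneous s.card := by
  have := IsHomogeneous.prod s (fun i => lin (a i)) (fun _ => 1) fun i _ => lin_homog _
  simpa [Qp] using this

theorem NonProp.relPrime (h : NonProp s a) {i j} (hi : i ∈ s) (hj : j ∈ s) (hij : i ≠ j) :
    IsRelPrime (lin (a i)) (lin (a j)) :=
  lin_relPrime (h.1 i hi) (h.1 j hj) (h.2 i hi j hj hij)

theorem Qp_dvd_det (h : NonProp s a) (M : Matrix (Fin ℓ) (Fin ℓ) (MvPolynomial (Fin ℓ) k))
    (hM : ∀ j, Log s a (M j)) : Qp s a ∣ M.det :=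
  Finset.prod_dvd_of_isRelPrime (fun _ hi _ hj hij => h.relPrime hi hj hij)
    fun i hi => lin_dvd_det (h.1 i hi) M fun j => hM j i hi

/-- Saito + Cramer, with explicit coefficients -/
theorem saito_gen (h : NonProp s a) (M : Matrix (Fin ℓ) (Fin ℓ) (MvPolynomial (Fin ℓ) k))
    (hM : ∀ j, Log s a (M j)) {c : k} (hc : c ≠ 0) (hdet : M.det = C c * Qp s a)
    (η) (hη : Log s a η) :
    ∃ f : Fin ℓ → MvPolynomial (Fin ℓ) k, η = ∑ j, f j • M j ∧
      ∀ j, f j * M.det = (M.updateRow j η).det := by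
  have hd : M.det ≠ 0 := by
    rw [hdet]; exact mul_ne_zero (by simpa using hc) (Qp_ne_zero h)
  have h1 : ∀ j, ∃ f, f * M.det = (M.updateRow j η).det := by
    intro j
    obtain ⟨u, hu⟩ := Qp_dvd_det h (M.updateRow j η) (fun i => by
      by_cases hij : i = j
      · subst hij; simpa using hη
      · rw [Matrix.updateRow_ne hij]; exact hM i)
    refine ⟨C c⁻¹ * u, ?_⟩
    rw [hdet, hu]
    have : (C c⁻¹ * C c : MvPolynomial (Fin ℓ) k) = 1 := by
      rw [← C_mul, inv_mul_cancel₀ hc, C_1]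
    linear_combination (u * Qp s a) * this
  choose f hf using h1
  refine ⟨f, ?_, hf⟩
  funext i
  have h2 : M.det • η = M.det • ∑ j, f j • M j := by
    have h3 : Matrix.vecMul (Matrix.cramer M.transpose η) M = M.det • η := by
      have := Matrix.mulVec_cramer M.transpose η
      rwa [Matrix.mulVec_transpose, Matrix.det_transpose] at this
    rw [← h3]
    funext i
    simp only [Matrix.vecMul, dotProduct, Matrix.cramer_transpose_apply, ← hf,
      Finset.sum_apply, Pi.smul_apply, smul_eq_mul, Finset.mul_sum]
    exact Finset.sum_congr rfl fun j _ => by ring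
  exact mul_left_cancel₀ hd (congrFun h2 i)

end family
end ArrAux

end

section

namespace ArrAux

section counting
variable {ℓ : ℕ}

/-- exponent vectors of weighted degree at most `n` -/
def Wt (w : Fin ℓ → ℕ) (n : ℕ) : Finset (Fin ℓ → ℕ) :=
  (Fintype.piFinset fun _ => Finset.range (n + 1)).filter fun β => ∑ j, w j * β j ≤ n

theorem mem_Wt {w : Fin ℓ → ℕ} (hw : ∀ j, 0 < w j) {n : ℕ} {β : Fin ℓ → ℕ} :
    β ∈ Wt w n ↔ ∑ j, w j * β j ≤ n := by
  simp only [Wt, Finset.mem_filter, Fintype.mem_piFinset, Finset.mem_range, and_iff_right_iff_imp]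
  intro h j
  have h1 : w j * β j ≤ ∑ j, w j * β j :=
    Finset.single_le_sum (f := fun j => w j * β j) (fun _ _ => Nat.zero_le _) (Finset.mem_univ j)
  have h2 : β j ≤ w j * β j := Nat.le_mul_of_pos_left _ (hw j)
  omega

theorem mem_Wt_one {n : ℕ} {β : Fin ℓ → ℕ} : β ∈ Wt (fun _ => 1) n ↔ ∑ j, β j ≤ n := by
  rw [mem_Wt (fun _ => one_pos)]; simp

theorem card_one_le (w : Fin ℓ → ℕ) (hw : ∀ j, 0 < w j) (n : ℕ) :
    (Wt (ℓ := ℓ) (fun _ => 1) n).card ≤ (∏ j, w j) * (Wt w n).card := by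
  rw [← Finset.card_range (∏ j, w j)]
  have : (Fintype.piFinset fun j => Finset.range (w j)).card = ∏ j, w j := by simp
  rw [Finset.card_range, ← this, ← Finset.card_product]
  refine Finset.card_le_card_of_injOn (fun γ => (fun j => γ j % w j, fun j => γ j / w j)) ?_ ?_
  · intro γ hγ
    simp only [Finset.mem_coe, mem_Wt_one] at hγ
    simp only [Finset.mem_coe, Finset.mem_product, Fintype.mem_piFinset, Finset.mem_range,
      mem_Wt hw]
    refine ⟨fun j => Nat.mod_lt _ (hw j), le_trans (Finset.sum_le_sum fun j _ => ?_) hγ⟩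
    exact Nat.mul_div_le _ _
  · intro γ _ γ' _ h
    simp only [Prod.mk.injEq] at h
    funext j
    have h1 := congrFun h.1 j
    have h2 := congrFun h.2 j
    rw [← Nat.mod_add_div (γ j) (w j), ← Nat.mod_add_div (γ' j) (w j), h1, h2]

theorem card_le_one (w : Fin ℓ → ℕ) (hw : ∀ j, 0 < w j) (n : ℕ) :
    (∏ j, w j) * (Wt w n).card ≤ (Wt (ℓ := ℓ) (fun _ => 1) (n + ∑ j, w j)).card := by
  have : (Fintype.piFinset fun j => Finset.range (w j)).card = ∏ j, w j := by simp
  rw [← this, ← Finset.card_product]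
  refine Finset.card_le_card_of_injOn (fun p => fun j => p.1 j + w j * p.2 j) ?_ ?_
  · rintro ⟨r, β⟩ h
    simp only [Finset.mem_coe, Finset.mem_product, Fintype.mem_piFinset, Finset.mem_range,
      mem_Wt hw] at h
    simp only [Finset.mem_coe, mem_Wt_one, Finset.sum_add_distrib]
    have : ∑ j, r j ≤ ∑ j, w j := Finset.sum_le_sum fun j _ => (h.1 j).le
    omega
  · rintro ⟨r, β⟩ h ⟨r', β'⟩ h' e
    simp only [Finset.mem_coe, Finset.mem_product, Fintype.mem_piFinset, Finset.mem_range] at h h'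
    simp only at e
    have h1 : r = r' := by
      funext j
      have := congrArg (· % w j) (congrFun e j)
      simpa [Nat.mod_eq_of_lt (h.1 j), Nat.mod_eq_of_lt (h'.1 j)] using this
    have h2 : β = β' := by
      funext j
      have e := congrFun e j
      simp only [h1] at e
      exact Nat.eq_of_mul_eq_mul_left (hw j) (Nat.add_left_cancel e)
    rw [h1, h2]

theorem card_one_bound (n : ℕ) : (Wt (ℓ := ℓ) (fun _ => 1) n).card ≤ (n + 1) ^ ℓ := by
  refine (Finset.card_filter_le _ _).trans ?_
  simp

theorem card_one_pos (n : ℕ) : 1 ≤ (Wt (ℓ := ℓ) (fun _ => 1) n).card :=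
  Finset.card_pos.2 ⟨0, by simp [mem_Wt_one]⟩

theorem growth (t : ℕ → ℕ) (ℓ : ℕ) (h1 : ∀ n, 1 ≤ t n) (h2 : ∀ n, t n ≤ (n + 1) ^ ℓ)
    (M D : ℕ) (h : ∀ n, (M + 1) * t n ≤ M * t (n + D)) : False := by
  rcases Nat.eq_zero_or_pos M with rfl | hM
  · have := h 0; have := h1 0; omega
  have key : ∀ k, (M + 1) ^ k ≤ M ^ k * t (k * D) := by
    intro k
    induction k with
    | zero => simpa using h1 0
    | succ k ih =>
      calc (M + 1) ^ (k + 1) = (M + 1) * (M + 1) ^ k := by ring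
        _ ≤ (M + 1) * (M ^ k * t (k * D)) := Nat.mul_le_mul_left _ ih
        _ = M ^ k * ((M + 1) * t (k * D)) := by ring
        _ ≤ M ^ k * (M * t (k * D + D)) := Nat.mul_le_mul_left _ (h _)
        _ = M ^ (k + 1) * t ((k + 1) * D) := by rw [← Nat.succ_mul]; ring
  have hMr : (0 : ℝ) < M := by exact_mod_cast hM
  set r : ℝ := (M + 1) / M with hr
  have hr1 : 1 < r := by rw [hr, lt_div_iff₀ hMr]; linarith
  have key2 : ∀ k : ℕ, r ^ k ≤ ((D : ℝ) + 1) ^ ℓ * ((k : ℝ) + 1) ^ ℓ := by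
    intro k
    have h3 : ((M : ℝ) + 1) ^ k ≤ M ^ k * ((k * D : ℕ) + 1) ^ ℓ := by
      have := (key k).trans (Nat.mul_le_mul_left _ (h2 (k * D)))
      exact_mod_cast this
    rw [hr, div_pow, div_le_iff₀ (by positivity), ← mul_pow, mul_comm]
    refine h3.trans ?_
    gcongr
    push_cast
    nlinarith [(Nat.cast_nonneg k : (0:ℝ) ≤ k), (Nat.cast_nonneg D : (0:ℝ) ≤ D)]
  have lim := tendsto_pow_const_div_const_pow_of_one_lt ℓ hr1
  have lim2 := (lim.comp (Filter.tendsto_add_atTop_nat 1))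
  have hε : (0 : ℝ) < 1 / (r * ((D : ℝ) + 1) ^ ℓ) := by positivity
  obtain ⟨k, hk⟩ := (lim2.eventually (gt_mem_nhds hε)).exists
  simp only [Function.comp] at hk
  have h5 := key2 k
  have hrp : 0 < r := by linarith
  rw [div_lt_div_iff₀ (by positivity) (by positivity)] at hk
  push_cast at hk
  rw [pow_succ] at hk
  nlinarith [mul_le_mul_of_nonneg_left h5 hrp.le]

end counting

theorem card_le_of_indep {K M ι : Type*} [Field K] [AddCommGroup M] [Module K M] [Fintype ι]
    (v : ι → M) (hv : LinearIndependent K v) (s : Finset M)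
    (h : ∀ i, v i ∈ Submodule.span K (s : Set M)) : Fintype.card ι ≤ s.card := by
  let v' : ι → Submodule.span K (s : Set M) := fun i => ⟨v i, h i⟩
  have hv' : LinearIndependent K v' := by
    apply LinearIndependent.of_comp (Submodule.subtype _)
    exact hv
  have := hv'.fintype_card_le_finrank
  exact this.trans (finrank_span_finset_le_card s)

end ArrAux

end

section

namespace ArrAux
open MvPolynomial

section ideal
variable {R : Type*} [CommRing R] (m : Ideal R)

/-- `a ≡ b` in `𝔪^n / 𝔪^(n+1)` -/
def Cg (n : ℕ) (a b : R) : Prop := a ∈ m ^ n ∧ b ∈ m ^ n ∧ a - b ∈ m ^ (n + 1)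

variable {m}
theorem Cg.mul {n n' : ℕ} {a b a' b' : R} (h : Cg m n a b) (h' : Cg m n' a' b') :
    Cg m (n + n') (a * a') (b * b') := by
  refine ⟨?_, ?_, ?_⟩
  · rw [pow_add]; exact Ideal.mul_mem_mul h.1 h'.1
  · rw [pow_add]; exact Ideal.mul_mem_mul h.2.1 h'.2.1
  · have : a * a' - b * b' = (a - b) * a' + b * (a' - b') := by ring
    rw [this]
    apply add_mem
    · rw [show n + n' + 1 = (n + 1) + n' by ring, pow_add]; exact Ideal.mul_mem_mul h.2.2 h'.1
    · rw [show n + n' + 1 = n + (n' + 1) by ring, pow_add]; exact Ideal.mul_mem_mul h.2.1 h'.2.2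

theorem Cg.one : Cg m 0 1 1 := ⟨by simp, by simp, by simp⟩

theorem Cg.pow {n : ℕ} {a b : R} (h : Cg m n a b) (r : ℕ) : Cg m (n * r) (a ^ r) (b ^ r) := by
  induction r with
  | zero => simpa using Cg.one
  | succ r ih => rw [pow_succ, pow_succ, Nat.mul_succ]; exact ih.mul h

theorem Cg.prod {ι : Type*} (s : Finset ι) {n : ι → ℕ} {a b : ι → R}
    (h : ∀ i ∈ s, Cg m (n i) (a i) (b i)) :
    Cg m (∑ i ∈ s, n i) (∏ i ∈ s, a i) (∏ i ∈ s, b i) := by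
  classical
  induction s using Finset.induction_on with
  | empty => simpa using Cg.one
  | insert i s hi ih =>
    rw [Finset.sum_insert hi, Finset.prod_insert hi, Finset.prod_insert hi]
    exact (h i (by simp)).mul (ih fun j hj => h j (by simp [hj]))
end ideal

section bez
set_option linter.unusedSectionVars false
variable {F : Type*} [Field F] [Fintype F] {ℓ : ℕ}
  (f : Fin ℓ → MvPolynomial (Fin ℓ) F) (θ : Fin ℓ → Fin ℓ → MvPolynomial (Fin ℓ) F)

/-- monomials in the `f j` -/
noncomputable def fm (β : Fin ℓ → ℕ) : MvPolynomial (Fin ℓ) F := ∏ j, f j ^ β j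

theorem fm_deg {n : Fin ℓ → ℕ} (hf : ∀ j, (f j).totalDegree ≤ n j) (β : Fin ℓ → ℕ) :
    (fm f β).totalDegree ≤ ∑ j, n j * β j := by
  refine (totalDegree_finsetProd _ _).trans (Finset.sum_le_sum fun j _ => ?_)
  refine (totalDegree_pow _ _).trans ?_
  rw [mul_comm]; exact Nat.mul_le_mul_right _ (hf j)

theorem mem_m_iff (p : MvPolynomial (Fin ℓ) F) :
    p ∈ idealOfVars (Fin ℓ) F ↔ constantCoeff p = 0 := by
  have := mem_pow_idealOfVars_iff' (R := F) 1 p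
  rw [pow_one] at this
  rw [this]
  constructor
  · intro h; exact h 0 (by simp)
  · intro h x hx
    have : x = 0 := by
      rw [← Finsupp.degree_eq_zero_iff]; omega
    rw [this]; exact h

theorem exists_chart
    (hrel : ∀ i, (X i : MvPolynomial (Fin ℓ) F) ^ Fintype.card F - X i = ∑ j, f j * θ j i)
    (v : Fin ℓ → F) (hv : ∀ j, eval v (f j) = 0)
    (hdet : (Matrix.of fun j i => eval v (θ j i)).det ≠ 0) :
    ∃ T : MvPolynomial (Fin ℓ) F →ₐ[F] MvPolynomial (Fin ℓ) F,
      (∀ p, constantCoeff (T p) = eval v p) ∧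
      ∀ j, Cg (idealOfVars (Fin ℓ) F) 1 (T (f j)) (X j) := by
  set Θ : Matrix (Fin ℓ) (Fin ℓ) F := Matrix.of fun j i => eval v (θ j i) with hΘ
  set m := idealOfVars (Fin ℓ) F with hm
  obtain ⟨T, hT0⟩ : ∃ T : MvPolynomial (Fin ℓ) F →ₐ[F] MvPolynomial (Fin ℓ) F,
      ∀ i, T (X i) = C (v i) - ∑ j, C (Θ j i) * X j :=
    ⟨aeval fun i => C (v i) - ∑ j, C (Θ j i) * X j, fun i => by simp⟩
  have hT : ∀ p, constantCoeff (T p) = eval v p := by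
    intro p
    have : (constantCoeff.comp T.toRingHom) = eval v := by
      ext i
      · simp
      · simp [hT0]
    exact congrArg (fun g => g p) this
  refine ⟨T, hT, ?_⟩
  have hX : ∀ j, (X j : MvPolynomial (Fin ℓ) F) ∈ m := fun j => by rw [mem_m_iff]; simp
  have hTf : ∀ j, T (f j) ∈ m := fun j => by rw [mem_m_iff, hT, hv]
  have hTθ : ∀ j i, T (θ j i) - C (Θ j i) ∈ m := fun j i => by
    rw [mem_m_iff, map_sub, hT]; simp [hΘ]
  have hq : 2 ≤ Fintype.card F := Fintype.one_lt_card
  have key : ∀ i, ∑ j, C (Θ j i) * (T (f j) - X j) ∈ m ^ 2 := by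
    intro i
    have h1 := congrArg T (hrel i)
    rw [map_sub, map_pow, map_sum] at h1
    simp only [map_mul] at h1
    set L : MvPolynomial (Fin ℓ) F := ∑ j, C (Θ j i) * X j with hL
    have hTX : T (X i) = C (v i) - L := hT0 i
    have hLm : L ∈ m := Ideal.sum_mem _ fun j _ => Ideal.mul_mem_left _ _ (hX j)
    have hfrob : (C (v i) - L) ^ Fintype.card F = C (v i) - L ^ Fintype.card F := by
      have := map_sub (FiniteField.frobeniusAlgHom F (MvPolynomial (Fin ℓ) F)) (C (v i)) L
      simp only [FiniteField.coe_frobeniusAlgHom] at this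
      rw [this, ← C_pow, FiniteField.pow_card]
    rw [hTX, hfrob] at h1
    have h2 : ∑ j, C (Θ j i) * (T (f j) - X j) =
        -(L ^ Fintype.card F) - ∑ j, T (f j) * (T (θ j i) - C (Θ j i)) := by
      have e1 : ∑ j, C (Θ j i) * (T (f j) - X j) = ∑ j, C (Θ j i) * T (f j) - L := by
        simp [mul_sub, Finset.sum_sub_distrib, hL]
      have e2 : ∑ j, T (f j) * (T (θ j i) - C (Θ j i)) =
          ∑ j, T (f j) * T (θ j i) - ∑ j, C (Θ j i) * T (f j) := by
        simp only [mul_sub, Finset.sum_sub_distrib]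
        congr 1
        exact Finset.sum_congr rfl fun j _ => mul_comm _ _
      generalize L ^ Fintype.card F = N at h1 ⊢
      linear_combination e1 + e2 - h1
    rw [h2]
    apply sub_mem
    · exact neg_mem (Ideal.pow_le_pow_right hq (Ideal.pow_mem_pow hLm _))
    · refine Ideal.sum_mem _ fun j _ => ?_
      rw [pow_two]; exact Ideal.mul_mem_mul (hTf j) (hTθ j i)
  intro j
  refine ⟨by simpa using hTf j, by simpa using hX j, ?_⟩
  have hinv : Θ * Θ⁻¹ = 1 := Matrix.mul_nonsing_inv _ (isUnit_iff_ne_zero.2 hdet)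
  have h3 : T (f j) - X j = ∑ i, C (Θ⁻¹ i j) * ∑ j', C (Θ j' i) * (T (f j') - X j') := by
    simp only [Finset.mul_sum]
    rw [Finset.sum_comm]
    have : ∀ j', ∑ i, C (Θ⁻¹ i j) * (C (Θ j' i) * (T (f j') - X j')) =
        C ((1 : Matrix (Fin ℓ) (Fin ℓ) F) j' j) * (T (f j') - X j') := by
      intro j'
      rw [← hinv, Matrix.mul_apply, map_sum, Finset.sum_mul]
      refine Finset.sum_congr rfl fun i _ => ?_
      rw [C_mul]; ring
    rw [Finset.sum_congr rfl fun j' _ => this j', Finset.sum_eq_single j]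
    · simp
    · intro b _ hb; simp [Matrix.one_apply_ne hb]
    · simp
  rw [h3]
  exact Ideal.sum_mem _ fun i _ => Ideal.mul_mem_left _ _ (key i)

variable {f θ}

theorem indep_fm [DecidableEq F] {V : Finset (Fin ℓ → F)} (P : Finset (Fin ℓ → ℕ))
    (hrel : ∀ i, (X i : MvPolynomial (Fin ℓ) F) ^ Fintype.card F - X i = ∑ j, f j * θ j i)
    (hV : ∀ v ∈ V, ∀ j, eval v (f j) = 0)
    (hdet : ∀ v ∈ V, (Matrix.of fun j i => eval v (θ j i)).det ≠ 0) :
    LinearIndependent F (fun p : V × P => indicator p.1.1 * fm f p.2.1) := by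
  rw [Fintype.linearIndependent_iff]
  intro c hc
  by_contra! hne
  have hne' : (Finset.univ.filter fun p => c p ≠ 0).Nonempty := by
    obtain ⟨p, hp⟩ := hne; exact ⟨p, by simpa using hp⟩
  obtain ⟨p0, hp0, hmin⟩ := Finset.exists_min_image _ (fun p : V × P => ∑ j, p.2.1 j) hne'
  obtain ⟨T, hT, hTf⟩ := exists_chart f θ hrel p0.1.1 (hV _ p0.1.2) (hdet _ p0.1.2)
  set m := idealOfVars (Fin ℓ) F with hm
  simp only [Finset.mem_filter, Finset.mem_univ, true_and] at hp0 hmin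
  let b0 : Fin ℓ →₀ ℕ := Finsupp.equivFunOnFinite.symm p0.2.1
  have hb0 : b0.degree = ∑ j, p0.2.1 j := by
    rw [Finsupp.degree_eq_sum]; simp [b0]
  have h1 : ∑ p, c p * coeff b0 (T (indicator p.1.1 * fm f p.2.1)) = 0 := by
    have := congrArg (fun z => coeff b0 (T z)) hc
    simpa [map_sum, coeff_sum] using this
  have hz : ∀ β : Fin ℓ → ℕ, fm (fun j => (X j : MvPolynomial (Fin ℓ) F)) β =
      monomial (Finsupp.equivFunOnFinite.symm β) 1 := by
    intro β
    rw [monomial_eq, C_1, one_mul, Finsupp.prod_fintype _ _ (by simp)]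
    simp [fm]
  have h2 : ∀ p : V × P, Cg m (∑ j, p.2.1 j) (T (fm f p.2.1))
      (monomial (Finsupp.equivFunOnFinite.symm p.2.1) 1) := by
    intro p
    rw [← hz]
    have : T (fm f p.2.1) = ∏ j, T (f j) ^ p.2.1 j := by simp [fm, map_prod]
    rw [this]
    refine Cg.prod _ fun j _ => ?_
    have := (hTf j).pow (p.2.1 j)
    rwa [one_mul] at this
  have hco : ∀ n (z : MvPolynomial (Fin ℓ) F), z ∈ m ^ (n + 1) → b0.degree ≤ n → coeff b0 z = 0 := by
    intro n z hz hn
    exact (mem_pow_idealOfVars_iff' _ _).1 hz b0 (by omega)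
  have h3 : ∀ p, p ≠ p0 → c p * coeff b0 (T (indicator p.1.1 * fm f p.2.1)) = 0 := by
    intro p hp
    by_cases hcp : c p = 0
    · rw [hcp, zero_mul]
    have hle := hmin p hcp
    rw [← hb0] at hle
    by_cases hv : p.1 = p0.1
    · have h4 : Cg m 0 (T (indicator p.1.1)) 1 := by
        refine ⟨by simp, by simp, ?_⟩
        rw [zero_add, pow_one, mem_m_iff, map_sub, hT, hv, eval_indicator_apply_eq_one]
        simp
      have h5 := h4.mul (h2 p)
      rw [zero_add, one_mul, ← map_mul] at h5
      have h6 := hco _ _ h5.2.2 hle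
      rw [coeff_sub, coeff_monomial, if_neg, sub_zero] at h6
      · rw [h6, mul_zero]
      · intro h
        apply hp
        refine Prod.ext hv (Subtype.ext ?_)
        exact Finsupp.equivFunOnFinite.symm.injective h
    · have h4 : T (indicator p.1.1) ∈ m := by
        rw [mem_m_iff, hT, eval_indicator_apply_eq_zero]
        exact fun h => hv (Subtype.ext h.symm)
      have h5 : T (indicator p.1.1 * fm f p.2.1) ∈ m ^ (∑ j, p.2.1 j + 1) := by
        rw [map_mul, pow_succ']; exact Ideal.mul_mem_mul h4 (h2 p).1
      rw [hco _ _ h5 hle, mul_zero]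
  rw [Finset.sum_eq_single p0 (fun p _ hp => h3 p hp) (by simp)] at h1
  have h4 : Cg m 0 (T (indicator p0.1.1)) 1 := by
    refine ⟨by simp, by simp, ?_⟩
    rw [zero_add, pow_one, mem_m_iff, map_sub, hT, eval_indicator_apply_eq_one]
    simp
  have h5 := h4.mul (h2 p0)
  rw [zero_add, one_mul, ← map_mul] at h5
  have h6 := hco _ _ h5.2.2 hb0.le
  rw [coeff_sub, coeff_monomial, if_pos rfl, sub_eq_zero] at h6
  rw [h6, mul_one] at h1
  exact hp0 h1
end bez
end ArrAux

end

section

namespace ArrAux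
open MvPolynomial

section bez2
set_option linter.unusedSectionVars false
variable {F : Type*} [Field F] {ℓ : ℕ}

/-- monomial with exponent function -/
noncomputable def mn (γ : Fin ℓ → ℕ) : MvPolynomial (Fin ℓ) F :=
  monomial (Finsupp.equivFunOnFinite.symm γ) 1

theorem mn_add (γ γ' : Fin ℓ → ℕ) : (mn (γ + γ') : MvPolynomial (Fin ℓ) F) = mn γ * mn γ' := by
  unfold mn
  rw [monomial_mul, one_mul]
  rw [show Finsupp.equivFunOnFinite.symm (γ + γ') = Finsupp.equivFunOnFinite.symm γ +
    Finsupp.equivFunOnFinite.symm γ' from by ext; simp]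

theorem mn_deg (γ : Fin ℓ → ℕ) : (mn γ : MvPolynomial (Fin ℓ) F).totalDegree ≤ ∑ j, γ j := by
  unfold mn
  refine (totalDegree_monomial_le _ _).trans ?_
  rw [Finsupp.sum_fintype _ _ (by simp)]; simp

theorem span_mn {N : ℕ} {p : MvPolynomial (Fin ℓ) F} (h : p.totalDegree ≤ N) (W : Submodule F (MvPolynomial (Fin ℓ) F))
    (hW : ∀ γ : Fin ℓ → ℕ, ∑ j, γ j ≤ N → mn γ ∈ W) : p ∈ W := by
  rw [p.as_sum]
  refine Submodule.sum_mem _ fun x hx => ?_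
  have h1 : x.sum (fun _ e => e) ≤ N := (le_totalDegree hx).trans h
  rw [Finsupp.sum_fintype _ _ (by simp)] at h1
  have h2 := hW x h1
  have : monomial x (coeff x p) = coeff x p • (mn x : MvPolynomial (Fin ℓ) F) := by
    unfold mn
    rw [smul_monomial, smul_eq_mul, mul_one]
    congr 1
    simp
  rw [this]; exact Submodule.smul_mem _ _ h2

theorem mn_indep (P : Finset (Fin ℓ → ℕ)) :
    LinearIndependent F (fun γ : P => (mn γ.1 : MvPolynomial (Fin ℓ) F)) := by
  have := (basisMonomials (Fin ℓ) F).linearIndependent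
  have h2 := this.comp (fun γ : P => Finsupp.equivFunOnFinite.symm γ.1)
    (fun a b h => Subtype.ext (Finsupp.equivFunOnFinite.symm.injective h))
  have h3 : (fun γ : P => (mn γ.1 : MvPolynomial (Fin ℓ) F)) =
    (basisMonomials (Fin ℓ) F) ∘ fun γ : P => Finsupp.equivFunOnFinite.symm γ.1 := by
    funext γ; simp [mn]
  rw [h3]; exact h2

theorem upper_bound [Fintype F] {f : Fin ℓ → MvPolynomial (Fin ℓ) F}
    {θ : Fin ℓ → Fin ℓ → MvPolynomial (Fin ℓ) F} {w : Fin ℓ → ℕ} (hw : ∀ j, 0 < w j)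
    (hf : ∀ j, (f j).totalDegree ≤ w j)
    (hrel : ∀ i, (X i : MvPolynomial (Fin ℓ) F) ^ Fintype.card F - X i = ∑ j, f j * θ j i)
    {V : Finset (Fin ℓ → F)} (hV : ∀ v ∈ V, ∀ j, eval v (f j) = 0)
    (hdet : ∀ v ∈ V, (Matrix.of fun j i => eval v (θ j i)).det ≠ 0) :
    V.card ≤ ∏ j, w j := by
  classical
  set D := V.sup fun v => (indicator v).totalDegree with hD
  have key : ∀ n, V.card * (Wt w n).card ≤ (Wt (ℓ := ℓ) (fun _ => 1) (n + D)).card := by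
    intro n
    have h1 := indep_fm (Wt w n) hrel hV hdet
    have h2 := card_le_of_indep _ h1 ((Wt (ℓ := ℓ) (fun _ => 1) (n + D)).image mn) ?_
    · simp only [Fintype.card_prod, Fintype.card_coe] at h2
      exact h2.trans Finset.card_image_le
    · rintro ⟨v, β⟩
      refine span_mn (N := n + D) ?_ _ fun γ hγ => Submodule.subset_span ?_
      · refine (totalDegree_mul _ _).trans ?_
        have e1 : (indicator v.1).totalDegree ≤ D :=
          Finset.le_sup (f := fun v => (indicator v).totalDegree) v.2
        have e2 := fm_deg f hf β.1
        have e3 := (mem_Wt hw).1 β.2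
        simp only
        omega
      · simp only [Finset.coe_image]
        exact ⟨γ, mem_Wt_one.2 hγ, rfl⟩
  by_contra! hlt
  refine growth (fun n => (Wt (ℓ := ℓ) (fun _ => 1) n).card) ℓ card_one_pos card_one_bound
    (∏ j, w j) D fun n => ?_
  have h1 := card_one_le w hw n
  calc (∏ j, w j + 1) * (Wt (ℓ := ℓ) (fun _ => 1) n).card
      ≤ V.card * ((∏ j, w j) * (Wt w n).card) := Nat.mul_le_mul hlt h1
    _ = (∏ j, w j) * (V.card * (Wt w n).card) := by ring
    _ ≤ _ := Nat.mul_le_mul_left _ (key n)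

theorem vanish [Fintype F] {f : Fin ℓ → MvPolynomial (Fin ℓ) F}
    {θ : Fin ℓ → Fin ℓ → MvPolynomial (Fin ℓ) F}
    (hrel : ∀ i, (X i : MvPolynomial (Fin ℓ) F) ^ Fintype.card F - X i = ∑ j, f j * θ j i)
    {V : Finset (Fin ℓ → F)} (hV : ∀ v, (∀ j, eval v (f j) = 0) → v ∈ V)
    (p : MvPolynomial (Fin ℓ) F) (hp : ∀ v ∈ V, eval v p = 0) :
    ∃ h : Fin ℓ → MvPolynomial (Fin ℓ) F, p = ∑ j, f j * h j := by
  classical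
  suffices hI : p ∈ Ideal.span (Set.range f) by
    obtain ⟨h, hh⟩ := (Ideal.mem_span_range_iff_exists_fun).1 hI
    exact ⟨h, by rw [← hh]; exact Finset.sum_congr rfl fun j _ => mul_comm _ _⟩
  have hfI : ∀ j, f j ∈ Ideal.span (Set.range f) := fun j => Ideal.subset_span ⟨j, rfl⟩
  have h1 : ∀ v : Fin ℓ → F, ∃ g ∈ Ideal.span (Set.range f), eval v g = eval v p ∧
      ∀ u, u ≠ v → eval u g = 0 := by
    intro v
    by_cases hv : v ∈ V
    · exact ⟨0, zero_mem _, by simp [hp v hv], by simp⟩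
    · have : ∃ j, eval v (f j) ≠ 0 := by by_contra! h; exact hv (hV v h)
      obtain ⟨j, hj⟩ := this
      refine ⟨C (eval v p / eval v (f j)) * indicator v * f j, Ideal.mul_mem_left _ _ (hfI j), ?_, ?_⟩
      · rw [map_mul, map_mul, eval_C, eval_indicator_apply_eq_one, mul_one, div_mul_cancel₀ _ hj]
      · intro u hu
        rw [map_mul, map_mul, eval_indicator_apply_eq_zero _ _ hu]; simp
  choose g hgI hg1 hg2 using h1
  have h2 : p - ∑ v, g v ∈ Ideal.span (Set.range f) := by
    have hv0 : ∀ u : Fin ℓ → F, eval u (p - ∑ v, g v) = 0 := by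
      intro u
      rw [map_sub, map_sum, Finset.sum_eq_single u (fun v _ hv => hg2 v u hv.symm) (by simp), hg1,
        sub_self]
    obtain ⟨h, _, hh⟩ := combinatorial_nullstellensatz_exists_linearCombination
      (fun _ : Fin ℓ => (Finset.univ : Finset F)) (fun _ => Finset.univ_nonempty) (p - ∑ v, g v)
      (fun x _ => hv0 x)
    rw [hh, Finsupp.linearCombination_apply, Finsupp.sum]
    refine Ideal.sum_mem _ fun i _ => ?_
    rw [smul_eq_mul]
    apply Ideal.mul_mem_left
    have h3 : ∏ r ∈ (Finset.univ : Finset F), (X i - C r : MvPolynomial (Fin ℓ) F) =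
        X i ^ Fintype.card F - X i := by
      have := Polynomial.prod_multiset_X_sub_C_of_monic_of_roots_card_eq
        (p := (Polynomial.X ^ Fintype.card F - Polynomial.X : Polynomial F))
        (by
          apply Polynomial.monic_X_pow_sub
          simpa using (Fintype.one_lt_card (α := F)))
        (by
          rw [FiniteField.roots_X_pow_card_sub_X, FiniteField.X_pow_card_sub_X_natDegree_eq _
            Fintype.one_lt_card]; rfl)
      rw [FiniteField.roots_X_pow_card_sub_X] at this
      have h4 := congrArg (Polynomial.aeval (X i : MvPolynomial (Fin ℓ) F)) this
      change Polynomial.aeval (X i) (∏ r : F, _) = _ at h4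
      simpa [map_prod, algebraMap_eq] using h4
    rw [h3, hrel]
    exact Ideal.sum_mem _ fun j _ => Ideal.mul_mem_right _ _ (hfI j)
  have := add_mem h2 (Ideal.sum_mem _ fun v (_ : v ∈ Finset.univ) => hgI v)
  rwa [sub_add_cancel] at this

end bez2
end ArrAux

end

section

namespace ArrAux
open MvPolynomial

section bez3
set_option linter.unusedSectionVars false
variable {F : Type*} [Field F] {ℓ : ℕ}

theorem fm_add (f : Fin ℓ → MvPolynomial (Fin ℓ) F) (β β' : Fin ℓ → ℕ) :
    fm f (β + β') = fm f β * fm f β' := by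
  simp [fm, pow_add, Finset.prod_mul_distrib]

theorem fm_single (f : Fin ℓ → MvPolynomial (Fin ℓ) F) (j : Fin ℓ) :
    fm f (Pi.single j 1) = f j := by
  unfold fm
  rw [Finset.prod_eq_single j]
  · simp
  · intro b _ hb; simp [Pi.single_eq_of_ne hb]
  · simp

theorem mn_single (j : Fin ℓ) (n : ℕ) :
    (mn (Pi.single j n) : MvPolynomial (Fin ℓ) F) = X j ^ n := by
  unfold mn
  rw [X_pow_eq_monomial, show Finsupp.equivFunOnFinite.symm (Pi.single j n) = Finsupp.single j n
    from by ext i; simp [Finsupp.single_eq_pi_single]]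

/-- the span `U n` -/
noncomputable def US (f : Fin ℓ → MvPolynomial (Fin ℓ) F) (w : Fin ℓ → ℕ) (c0 n : ℕ) :
    Submodule F (MvPolynomial (Fin ℓ) F) :=
  Submodule.span F {p | ∃ β γ : Fin ℓ → ℕ, ∑ j, w j * β j ≤ n ∧ ∑ j, γ j ≤ c0 ∧ p = fm f β * mn γ}

theorem US_mono (f : Fin ℓ → MvPolynomial (Fin ℓ) F) (w : Fin ℓ → ℕ) (c0 : ℕ) {n n' : ℕ}
    (h : n ≤ n') : US f w c0 n ≤ US f w c0 n' := by
  apply Submodule.span_mono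
  rintro p ⟨β, γ, h1, h2, h3⟩
  exact ⟨β, γ, h1.trans h, h2, h3⟩

theorem wt_add (w β β' : Fin ℓ → ℕ) :
    ∑ j, w j * (β + β') j = ∑ j, w j * β j + ∑ j, w j * β' j := by
  simp [mul_add, Finset.sum_add_distrib]

theorem wt_single (w : Fin ℓ → ℕ) (j : Fin ℓ) :
    ∑ i, w i * (Pi.single j 1 : Fin ℓ → ℕ) i = w j := by
  rw [Finset.sum_eq_single j]
  · simp
  · intro b _ hb; simp [Pi.single_eq_of_ne hb]
  · simp

theorem US_mul (f : Fin ℓ → MvPolynomial (Fin ℓ) F) (w : Fin ℓ → ℕ) (c0 : ℕ) {n : ℕ} (j : Fin ℓ)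
    {p} (h : p ∈ US f w c0 n) : f j * p ∈ US f w c0 (n + w j) := by
  unfold US at h
  induction h using Submodule.span_induction with
  | mem p hp =>
    obtain ⟨β, γ, h1, h2, rfl⟩ := hp
    refine Submodule.subset_span ⟨Pi.single j 1 + β, γ, ?_, h2, ?_⟩
    · rw [wt_add, wt_single]; omega
    · rw [fm_add, fm_single, mul_assoc]
  | zero => simp
  | add x y _ _ hx hy => rw [mul_add]; exact add_mem hx hy
  | smul a x _ hx => rw [mul_smul_comm]; exact Submodule.smul_mem _ _ hx

theorem mem_US [Fintype F] {f : Fin ℓ → MvPolynomial (Fin ℓ) F}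
    {θ : Fin ℓ → Fin ℓ → MvPolynomial (Fin ℓ) F} {w : Fin ℓ → ℕ} (hw : ∀ j, 0 < w j)
    (hrel : ∀ i, (X i : MvPolynomial (Fin ℓ) F) ^ Fintype.card F - X i = ∑ j, f j * θ j i)
    (hθ : ∀ j i, (θ j i).totalDegree + w j ≤ Fintype.card F) :
    ∀ n, ∀ p : MvPolynomial (Fin ℓ) F, p.totalDegree ≤ n →
      p ∈ US f w (ℓ * Fintype.card F) n := by
  have hq : 2 ≤ Fintype.card F := Fintype.one_lt_card
  set q := Fintype.card F with hqd
  intro n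
  induction n using Nat.strong_induction_on with
  | _ n ih =>
  intro p hp
  refine span_mn hp _ fun γ hγ => ?_
  by_cases hc : ∑ j, γ j ≤ ℓ * q
  · refine Submodule.subset_span ⟨0, γ, by simp, hc, by simp [fm]⟩
  push Not at hc
  have : ∃ i, q < γ i := by
    by_contra! h
    have := Finset.sum_le_sum fun i (_ : i ∈ Finset.univ) => h i
    simp at this
    omega
  obtain ⟨i, hi⟩ := this
  obtain ⟨δ, hδ⟩ : ∃ δ : Fin ℓ → ℕ, γ = (Pi.single i q : Fin ℓ → ℕ) + δ := by
    refine ⟨γ - Pi.single i q, ?_⟩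
    funext j
    by_cases hj : j = i
    · subst hj
      rw [Pi.add_apply, Pi.sub_apply, Pi.single_eq_same]; omega
    · rw [Pi.add_apply, Pi.sub_apply, Pi.single_eq_of_ne hj]; omega
  have hsum : ∑ j, γ j = q + ∑ j, δ j := by
    rw [hδ]; simp [Finset.sum_add_distrib]
  have hmn : (mn γ : MvPolynomial (Fin ℓ) F) = X i * mn δ + ∑ j, f j * (θ j i * mn δ) := by
    rw [hδ, mn_add, mn_single]
    have := hrel i
    have h2 : ∑ j, f j * (θ j i * mn δ) = (∑ j, f j * θ j i) * mn δ := by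
      rw [Finset.sum_mul]; exact Finset.sum_congr rfl fun j _ => by ring
    rw [h2, ← this]; ring
  have hδd := mn_deg (F := F) δ
  rw [hmn]
  apply add_mem
  · refine US_mono f w _ (show 1 + ∑ j, δ j ≤ n by omega) (ih _ (by omega) _ ?_)
    refine (totalDegree_mul _ _).trans ?_
    rw [totalDegree_X]; omega
  · refine Submodule.sum_mem _ fun j _ => ?_
    have h3 := hw j
    have h4 := hθ j i
    refine US_mono f w _ (show (q + ∑ j, δ j - w j) + w j ≤ n by omega)
      (US_mul f w _ j (ih _ (by omega) _ ?_))
    refine (totalDegree_mul _ _).trans ?_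
    omega

theorem lower_bound [Fintype F] {f : Fin ℓ → MvPolynomial (Fin ℓ) F}
    {θ : Fin ℓ → Fin ℓ → MvPolynomial (Fin ℓ) F} {w : Fin ℓ → ℕ} (hw : ∀ j, 0 < w j)
    (hrel : ∀ i, (X i : MvPolynomial (Fin ℓ) F) ^ Fintype.card F - X i = ∑ j, f j * θ j i)
    (hθ : ∀ j i, (θ j i).totalDegree + w j ≤ Fintype.card F)
    {V : Finset (Fin ℓ → F)} (hV : ∀ v, (∀ j, eval v (f j) = 0) → v ∈ V) :
    ∏ j, w j ≤ V.card := by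
  classical
  set c0 := ℓ * Fintype.card F with hc0
  have hU := mem_US hw hrel hθ
  rw [← hc0] at hU
  have hred : ∀ γ : Fin ℓ → ℕ, ∃ h : Fin ℓ → MvPolynomial (Fin ℓ) F,
      mn γ - ∑ v ∈ V, C (eval v (mn γ)) * indicator v = ∑ j, f j * h j := by
    intro γ
    refine vanish hrel hV _ fun v hv => ?_
    rw [map_sub, map_sum, Finset.sum_eq_single v]
    · simp [eval_indicator_apply_eq_one]
    · intro u _ hu
      rw [map_mul, eval_indicator_apply_eq_zero _ _ hu.symm, mul_zero]
    · exact fun h => absurd hv h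
  choose h hh using hred
  set c1 := (Wt (ℓ := ℓ) (fun _ => 1) c0).sup fun γ =>
    Finset.univ.sup fun j => (h γ j).totalDegree with hc1
  have hhd : ∀ γ : Fin ℓ → ℕ, ∑ j, γ j ≤ c0 → ∀ j, (h γ j).totalDegree ≤ c1 := by
    intro γ hγ j
    refine le_trans ?_ (Finset.le_sup (f := fun γ =>
      Finset.univ.sup fun j => (h γ j).totalDegree) (mem_Wt_one.2 hγ))
    exact Finset.le_sup (f := fun j => (h γ j).totalDegree) (Finset.mem_univ j)
  set c2 := c1 + ∑ j, w j with hc2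
  have hwj : ∀ j, w j ≤ ∑ j, w j := fun j =>
    Finset.single_le_sum (f := w) (fun _ _ => Nat.zero_le _) (Finset.mem_univ j)
  -- generators
  let G : ℕ → Finset (MvPolynomial (Fin ℓ) F) := fun m =>
    ((V ×ˢ Wt w (m + c2)).image fun p => indicator p.1 * fm f p.2) ∪
    ((Wt (ℓ := ℓ) (fun _ => 1) c0 ×ˢ (Wt w (m + c2) \ Wt w m)).image fun p => fm f p.2 * mn p.1)
  have hZ : ∀ m k (β γ : Fin ℓ → ℕ), m + c2 ≤ ∑ j, w j * β j + k →
      ∑ j, w j * β j ≤ m + c2 → ∑ j, γ j ≤ c0 →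
      fm f β * mn γ ∈ Submodule.span F (G m : Set (MvPolynomial (Fin ℓ) F)) := by
    intro m k
    induction k using Nat.strong_induction_on with
    | _ k ih =>
    intro β γ h1 h2 h3
    by_cases hm : ∑ j, w j * β j ≤ m
    · have e : (mn γ : MvPolynomial (Fin ℓ) F) =
          ∑ v ∈ V, C (eval v (mn γ)) * indicator v + ∑ j, f j * h γ j := by
        rw [← hh γ]; ring
      rw [e, mul_add, Finset.mul_sum, Finset.mul_sum]
      apply add_mem
      · refine Submodule.sum_mem _ fun v hv => ?_
        rw [show fm f β * (C (eval v (mn γ)) * indicator v) =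
          eval v (mn γ) • (indicator v * fm f β) by rw [smul_eq_C_mul]; ring]
        refine Submodule.smul_mem _ _ (Submodule.subset_span ?_)
        simp only [G, Finset.coe_union, Set.mem_union, Finset.mem_coe, Finset.mem_image,
          Finset.mem_product]
        exact Or.inl ⟨(v, β), ⟨hv, (mem_Wt hw).2 h2⟩, rfl⟩
      · refine Submodule.sum_mem _ fun j _ => ?_
        have hhU : h γ j ∈ US f w c0 c1 := hU _ _ (hhd γ h3 j)
        unfold US at hhU
        generalize h γ j = hp0 at hhU
        induction hhU using Submodule.span_induction with
        | mem p hp =>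
          obtain ⟨β', γ', g1, g2, rfl⟩ := hp
          rw [show fm f β * (f j * (fm f β' * mn γ')) = fm f (β + Pi.single j 1 + β') * mn γ' by
            rw [fm_add, fm_add, fm_single]; ring]
          have hwt : ∑ i, w i * (β + (Pi.single j 1 : Fin ℓ → ℕ) + β') i =
            ∑ i, w i * β i + w j + ∑ i, w i * β' i := by rw [wt_add, wt_add, wt_single]
          have := hw j
          have := hwj j
          have hk : w j ≤ k := by omega
          refine ih (k - w j) (by omega) _ _ ?_ ?_ g2
          · rw [hwt]; omega
          · rw [hwt]; omega
        | zero => simp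
        | add x y _ _ hx hy => rw [mul_add, mul_add]; exact add_mem hx hy
        | smul a x _ hx =>
          rw [mul_smul_comm, mul_smul_comm]; exact Submodule.smul_mem _ _ hx
    · refine Submodule.subset_span ?_
      simp only [G, Finset.coe_union, Set.mem_union, Finset.mem_coe, Finset.mem_image,
          Finset.mem_product, Finset.mem_sdiff]
      exact Or.inr ⟨(γ, β), ⟨mem_Wt_one.2 h3, (mem_Wt hw).2 h2, fun h => hm ((mem_Wt hw).1 h)⟩, rfl⟩
  set t0 := (Wt (ℓ := ℓ) (fun _ => 1) c0).card with ht0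
  have hcard : ∀ m, (Wt (ℓ := ℓ) (fun _ => 1) (m + c2)).card + t0 * (Wt w m).card ≤
      (V.card + t0) * (Wt w (m + c2)).card := by
    intro m
    have h1 := card_le_of_indep _ (mn_indep (F := F) (Wt (ℓ := ℓ) (fun _ => 1) (m + c2))) (G m) ?_
    · rw [Fintype.card_coe] at h1
      have h2 : (G m).card ≤ V.card * (Wt w (m + c2)).card +
          t0 * (Wt w (m + c2) \ Wt w m).card := by
        refine (Finset.card_union_le _ _).trans (add_le_add ?_ ?_)
        · exact Finset.card_image_le.trans (Finset.card_product _ _).le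
        · exact Finset.card_image_le.trans (Finset.card_product _ _).le
      have hsub : Wt w m ⊆ Wt w (m + c2) := fun β hβ =>
        (mem_Wt hw).2 (((mem_Wt hw).1 hβ).trans (by omega))
      have h3 := Finset.card_sdiff_add_card_eq_card hsub
      rw [← h3] at h2 ⊢
      nlinarith
    · rintro ⟨γ, hγ⟩
      have h2 : (mn γ : MvPolynomial (Fin ℓ) F) ∈ US f w c0 (m + c2) :=
        hU _ _ ((mn_deg γ).trans (mem_Wt_one.1 hγ))
      refine Submodule.span_le.2 ?_ h2
      rintro p ⟨β, γ', g1, g2, rfl⟩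
      exact hZ m (m + c2) β γ' (by omega) g1 g2
  by_contra! hlt
  refine growth (fun n => (Wt (ℓ := ℓ) (fun _ => 1) n).card) ℓ card_one_pos card_one_bound
    (V.card + t0) (c2 + ∑ j, w j) fun n => ?_
  have e1 := hcard n
  have e2 := card_one_le w hw n
  have e3 := card_le_one w hw (n + c2)
  have e4 : (Wt (ℓ := ℓ) (fun _ => 1) n).card ≤ (Wt (ℓ := ℓ) (fun _ => 1) (n + c2)).card :=
    Finset.card_le_card fun β hβ => mem_Wt_one.2 ((mem_Wt_one.1 hβ).trans (by omega))
  rw [← add_assoc]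
  generalize (Wt (ℓ := ℓ) (fun _ => 1) (n + c2 + ∑ j, w j)).card = t2 at *
  generalize (Wt (ℓ := ℓ) (fun _ => 1) (n + c2)).card = t1 at *
  generalize (Wt (ℓ := ℓ) (fun _ => 1) n).card = t at *
  generalize (Wt w (n + c2)).card = P2 at *
  generalize (Wt w n).card = P1 at *
  generalize ∏ j, w j = Pw at *
  calc (V.card + t0 + 1) * t ≤ (Pw + t0) * t := Nat.mul_le_mul_right _ (by omega)
    _ = Pw * t + t0 * t := by ring
    _ ≤ Pw * t1 + t0 * (Pw * P1) := by gcongr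
    _ = Pw * (t1 + t0 * P1) := by ring
    _ ≤ Pw * ((V.card + t0) * P2) := by gcongr
    _ = (V.card + t0) * (Pw * P2) := by ring
    _ ≤ _ := by gcongr

end bez3
end ArrAux

end

section

namespace ArrAux
open MvPolynomial

section ff
set_option linter.unusedSectionVars false

theorem det_deg {k : Type*} [Field k] {ℓ n : ℕ} (M : Matrix (Fin n) (Fin n) (MvPolynomial (Fin ℓ) k))
    (d : Fin n → ℕ) (h : ∀ j i, (M j i).totalDegree ≤ d j) : M.det.totalDegree ≤ ∑ j, d j := by
  rw [← Matrix.det_transpose, Matrix.det_apply]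
  refine totalDegree_finsetSum_le fun σ _ => ?_
  refine (totalDegree_smul_le _ _).trans ?_
  refine (totalDegree_finsetProd _ _).trans (Finset.sum_le_sum fun j _ => ?_)
  exact h _ _

theorem eval_lin {k : Type*} [Field k] {ℓ : ℕ} (a v : Fin ℓ → k) :
    eval v (lin a) = ∑ i, a i * v i := by simp [lin]

variable {F : Type*} [Field F] [Fintype F] {ℓ : ℕ} {ι : Type*}

theorem ff_count {s : Finset ι} {a : ι → Fin ℓ → F} (h : NonProp s a)
    (M : Matrix (Fin ℓ) (Fin ℓ) (MvPolynomial (Fin ℓ) F))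
    (hM : ∀ j, Log s a (M j)) {c : F} (hc : c ≠ 0) (hdet : M.det = C c * Qp s a)
    (d : Fin ℓ → ℕ) (hd : ∀ j i, (M j i).totalDegree ≤ d j) (hsum : ∑ j, d j = s.card)
    (hq : ∀ j, d j < Fintype.card F)
    (V : Finset (Fin ℓ → F)) (hV : ∀ v, v ∈ V ↔ ∀ i ∈ s, ∑ j, a i j * v j ≠ 0) :
    V.card = ∏ j, (Fintype.card F - d j) := by
  classical
  set q := Fintype.card F with hqd
  have hq2 : 2 ≤ q := Fintype.one_lt_card
  set η : Fin ℓ → MvPolynomial (Fin ℓ) F := fun i => X i ^ q - X i with hη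
  have happ : ∀ b : Fin ℓ → F, app b η = lin b * (lin b ^ (q - 1) - 1) := by
    intro b
    have h1 : lin b ^ q = ∑ i, C (b i) * X i ^ q := by
      have := map_sum (FiniteField.frobeniusAlgHom F (MvPolynomial (Fin ℓ) F))
        (fun i => C (b i) * X i) Finset.univ
      simp only [FiniteField.coe_frobeniusAlgHom] at this
      rw [lin, hqd, this]
      refine Finset.sum_congr rfl fun i _ => ?_
      rw [mul_pow, ← C_pow, FiniteField.pow_card]
    rw [mul_sub, mul_one, ← pow_succ', show q - 1 + 1 = q by omega, h1]
    simp [app, hη, lin, mul_sub, Finset.sum_sub_distrib]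
  have hηL : Log s a η := fun i _ => ⟨_, happ (a i)⟩
  obtain ⟨f, hf1, hf2⟩ := saito_gen h M hM hc hdet η hηL
  have hdet0 : M.det ≠ 0 := by
    rw [hdet]; exact mul_ne_zero (by simpa using hc) (Qp_ne_zero h)
  have hdetd : M.det.totalDegree = s.card := by
    apply IsHomogeneous.totalDegree _ hdet0
    rw [hdet]
    have := (isHomogeneous_C (Fin ℓ) c).mul (Qp_homog (s := s) (a := a))
    simpa using this
  have hfd : ∀ j, (f j).totalDegree ≤ q - d j := by
    intro j
    by_cases hj : f j = 0
    · rw [hj]; simp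
    have h1 := congrArg totalDegree (hf2 j)
    rw [totalDegree_mul_of_isDomain hj hdet0, hdetd] at h1
    have h2 := det_deg (M.updateRow j η) (Function.update d j q) (fun i i' => by
      by_cases hij : i = j
      · subst hij
        rw [Matrix.updateRow_self, Function.update_self]
        refine (totalDegree_sub _ _).trans ?_
        rw [totalDegree_X_pow, totalDegree_X]; simp; omega
      · rw [Matrix.updateRow_ne hij, Function.update_of_ne hij]; exact hd _ _)
    have h3 : ∑ i, Function.update d j q i + d j = ∑ i, d i + q := by
      rw [Finset.sum_update_of_mem (Finset.mem_univ j),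
        ← Finset.add_sum_erase _ _ (Finset.mem_univ j)]
      rw [Finset.sdiff_singleton_eq_erase]; ring
    omega
  have hrel : ∀ i, (X i : MvPolynomial (Fin ℓ) F) ^ q - X i = ∑ j, f j * M j i := by
    intro i
    have := congrFun hf1 i
    simpa [hη] using this
  have hMev : ∀ v, (Matrix.of fun j i => eval v (M j i)).det = c * ∏ i ∈ s, ∑ j, a i j * v j := by
    intro v
    have := congrArg (eval v) hdet
    rw [RingHom.map_det] at this
    rw [map_mul, eval_C, Qp, map_prod] at this
    simp only [eval_lin] at this
    rw [← this]; rfl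
  have hdetV : ∀ v ∈ V, (Matrix.of fun j i => eval v (M j i)).det ≠ 0 := by
    intro v hv
    rw [hMev]
    exact mul_ne_zero hc (Finset.prod_ne_zero_iff.2 ((hV v).1 hv))
  have hV1 : ∀ v ∈ V, ∀ j, eval v (f j) = 0 := by
    intro v hv j
    refine congrFun (Matrix.eq_zero_of_vecMul_eq_zero (hdetV v hv)
      (v := fun j => eval v (f j)) ?_) j
    funext i
    have := congrArg (eval v) (hrel i)
    simp only [map_sub, map_pow, eval_X, map_sum, map_mul, hqd, FiniteField.pow_card, sub_self] at this
    simp only [Matrix.vecMul, dotProduct, Matrix.of_apply, Pi.zero_apply]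
    exact this.symm
  have hV2 : ∀ v, (∀ j, eval v (f j) = 0) → v ∈ V := by
    intro v hv
    rw [hV]
    intro i hi h0
    have hg : ∀ j, ∃ g, app (a i) (M j) = lin (a i) * g := fun j => hM j i hi
    choose g hg using hg
    have h1 := happ (a i)
    rw [hf1, app_sum] at h1
    simp only [app_smul, hg] at h1
    have h2 : lin (a i) * ∑ j, f j * g j = lin (a i) * (lin (a i) ^ (q - 1) - 1) := by
      rw [← h1, Finset.mul_sum]
      exact Finset.sum_congr rfl fun j _ => by ring
    have h3 := congrArg (eval v) (mul_left_cancel₀ (lin_ne_zero (h.1 i hi)) h2)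
    rw [map_sum] at h3
    simp only [map_mul, hv, zero_mul, Finset.sum_const_zero, map_sub, map_pow, eval_lin, h0,
      map_one] at h3
    rw [zero_pow (by omega)] at h3
    simp at h3
  apply le_antisymm
  · exact upper_bound (fun j => Nat.sub_pos_of_lt (hq j)) hfd hrel hV1 hdetV
  · refine lower_bound (θ := M) (fun j => Nat.sub_pos_of_lt (hq j)) hrel (fun j i => ?_) hV2
    have := hd j i
    have := hq j
    omega
end ff
end ArrAux

end

section

namespace ArrAux

theorem jac_int : IsJacobsonRing ℤ := by
  rw [isJacobsonRing_iff_prime_eq]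
  intro P hP
  by_cases h0 : P = ⊥
  · subst h0
    rw [eq_bot_iff]
    intro x hx
    rw [Ideal.mem_jacobson_bot] at hx
    by_contra hne
    have hx0 : x ≠ 0 := hne
    -- 1 + x * (x * 3) is a unit, hence ± 1, contradiction
    have h1 := hx (3 * x)
    rw [Int.isUnit_iff] at h1
    have : 0 < x * x := mul_self_pos.2 hx0
    rcases h1 with h1 | h1 <;> nlinarith
  · have : P.IsMaximal := hP.isMaximal h0
    exact Ideal.jacobson_eq_self_of_isMaximal

theorem finite_field_of_finiteType {R k : Type} [Field k] [CommRing R] [Algebra.FiniteType ℤ R]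
    (f : R →+* k) (hf : Function.Surjective f) : Finite k := by
  have hft : Algebra.FiniteType ℤ k := Algebra.FiniteType.of_surjective f.toIntAlgHom hf
  have := jac_int
  have hfin : Module.Finite ℤ k := finite_of_finite_type_of_isJacobsonRing ℤ k
  have hni : ¬ Function.Injective (algebraMap ℤ k) := fun hi =>
    Int.not_isField (isField_of_isIntegral_of_isField hi (Field.toIsField k))
  obtain ⟨n, hn, hn0⟩ : ∃ n : ℤ, n ≠ 0 ∧ (n : k) = 0 := by
    by_contra! h
    refine hni ((injective_iff_map_eq_zero _).2 fun a ha => ?_)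
    by_contra hne
    exact h a hne (by simpa using ha)
  refine Module.finite_of_fg_torsion k ?_
  intro x
  refine ⟨⟨n, mem_nonZeroDivisors_of_ne_zero hn⟩, ?_⟩
  change n • x = 0
  rw [zsmul_eq_mul, hn0, zero_mul]

/-- ring homs to arbitrarily large finite fields -/
theorem exists_hom (R : Type) [CommRing R] [Nontrivial R] [Algebra.FiniteType ℤ R] (n : ℕ) :
    ∃ (F : Type) (_ : Field F) (_ : Fintype F), n ≤ Fintype.card F ∧ Nonempty (R →+* F) := by
  obtain ⟨m, hm⟩ := Ideal.exists_maximal R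
  let _ := Ideal.Quotient.field m
  have hfin : Finite (R ⧸ m) := finite_field_of_finiteType
    (Ideal.Quotient.mk m) Ideal.Quotient.mk_surjective
  obtain ⟨p, hp⟩ := CharP.exists (R ⧸ m)
  have hpp : Fact p.Prime := ⟨CharP.char_is_prime (R ⧸ m) p⟩
  refine ⟨FiniteField.Extension (R ⧸ m) p (n + 1), inferInstance, Fintype.ofFinite _, ?_,
    ⟨(algebraMap (R ⧸ m) _).comp (Ideal.Quotient.mk m)⟩⟩
  rw [Fintype.card_eq_nat_card, FiniteField.natCard_extension]
  have h2 : 2 ≤ Nat.card (R ⧸ m) := Finite.one_lt_card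
  calc n ≤ 2 ^ n := Nat.lt_two_pow_self.le
    _ ≤ 2 ^ (n + 1) := Nat.pow_le_pow_right (by norm_num) (by omega)
    _ ≤ _ := Nat.pow_le_pow_left h2 _
end ArrAux

end

section

namespace ArrAux
open MvPolynomial

/-- Certificates over a ring. -/
structure Cert (R : Type) [CommRing R] (ι : Type) [Fintype ι] (ℓ : ℕ) (d : Fin ℓ → ℕ)
    (r : Finset ι → ℕ) where
  a : ι → Fin ℓ → R
  b : ι → ι → Fin ℓ → R
  c : R
  c' : R
  M : Fin ℓ → Fin ℓ → MvPolynomial (Fin ℓ) R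
  g : ι → Fin ℓ → MvPolynomial (Fin ℓ) R
  P : ∀ B : Finset ι, Matrix B (Fin (r B)) R
  P' : ∀ B : Finset ι, Matrix (Fin (r B)) B R
  Q : ∀ B : Finset ι, Matrix (Fin (r B)) (Fin ℓ) R
  Q' : ∀ B : Finset ι, Matrix (Fin ℓ) (Fin (r B)) R
  hb1 : ∀ i j, ∑ t, a j t * b i j t = 1
  hb0 : ∀ i j, i ≠ j → ∑ t, a i t * b i j t = 0
  hc : c * c' = 1
  hM : ∀ i j, ∑ t, C (a i t) * M j t = (∑ t, C (a i t) * X t) * g i j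
  hdet : (Matrix.of M).det = C c * ∏ i, ∑ t, C (a i t) * X t
  hdeg : ∀ j i, (M j i).totalDegree ≤ d j
  hP : ∀ B, P' B * P B = 1
  hQ : ∀ B, Q B * Q' B = 1
  hPQ : ∀ B : Finset ι, (Matrix.of fun (i : B) t => a i t) = P B * Q B

variable {ι : Type} [Fintype ι] {ℓ : ℕ} {d : Fin ℓ → ℕ} {r : Finset ι → ℕ}

/-- base change -/
noncomputable def Cert.map {R S : Type} [CommRing R] [CommRing S] (φ : R →+* S)
    (D : Cert R ι ℓ d r) : Cert S ι ℓ d r where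
  a i t := φ (D.a i t)
  b i j t := φ (D.b i j t)
  c := φ D.c
  c' := φ D.c'
  M i j := MvPolynomial.map φ (D.M i j)
  g i j := MvPolynomial.map φ (D.g i j)
  P B := (D.P B).map φ
  P' B := (D.P' B).map φ
  Q B := (D.Q B).map φ
  Q' B := (D.Q' B).map φ
  hb1 i j := by rw [← map_one φ, ← D.hb1 i j]; simp
  hb0 i j h := by rw [← map_zero φ, ← D.hb0 i j h]; simp
  hc := by rw [← map_mul, D.hc, map_one]
  hM i j := by
    have := congrArg (MvPolynomial.map φ) (D.hM i j)
    simpa [map_sum, map_mul] using this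
  hdet := by
    have := congrArg (MvPolynomial.map φ) D.hdet
    rw [RingHom.map_det] at this
    simp only [map_mul, map_prod, map_sum, map_C, map_X] at this
    rw [← this]; rfl
  hdeg j i := (Finset.sup_mono (support_map_subset _ _)).trans (D.hdeg j i)
  hP B := by rw [← Matrix.map_mul, D.hP, Matrix.map_one _ (map_zero φ) (map_one φ)]
  hQ B := by rw [← Matrix.map_mul, D.hQ, Matrix.map_one _ (map_zero φ) (map_one φ)]
  hPQ B := by
    rw [← Matrix.map_mul, ← D.hPQ]; rfl

theorem ker_rank {F : Type} [Field F] {β : Type} [Fintype β] {n : ℕ} (P : Matrix β (Fin n) F)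
    (P' : Matrix (Fin n) β F) [DecidableEq β] (Q : Matrix (Fin n) (Fin ℓ) F)
    (Q' : Matrix (Fin ℓ) (Fin n) F)
    (hP : P' * P = 1) (hQ : Q * Q' = 1) :
    n ≤ ℓ ∧ Module.finrank F (LinearMap.ker (P * Q).mulVecLin) = ℓ - n := by
  have h1 : LinearMap.ker (P * Q).mulVecLin = LinearMap.ker Q.mulVecLin := by
    ext v
    simp only [LinearMap.mem_ker, Matrix.mulVecLin_apply]
    constructor
    · intro h
      have := congrArg P'.mulVec h
      rw [Matrix.mulVec_mulVec, ← Matrix.mul_assoc, hP, Matrix.one_mul, Matrix.mulVec_zero] at this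
      exact this
    · intro h
      rw [← Matrix.mulVec_mulVec, h, Matrix.mulVec_zero]
  have h2 : LinearMap.range Q.mulVecLin = ⊤ := by
    rw [LinearMap.range_eq_top]
    intro v
    refine ⟨Q'.mulVec v, ?_⟩
    rw [Matrix.mulVecLin_apply, Matrix.mulVec_mulVec, hQ, Matrix.one_mulVec]
  have h3 := LinearMap.finrank_range_add_finrank_ker Q.mulVecLin
  rw [h2, finrank_top] at h3
  simp only [Module.finrank_fintype_fun_eq_card, Fintype.card_fin] at h3
  rw [h1]
  omega

theorem Cert.count {F : Type} [Field F] [Fintype F] (D : Cert F ι ℓ d r)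
    (hsum : ∑ j, d j = Fintype.card ι) (hq : ∀ j, d j < Fintype.card F) :
    ∑ B : Finset ι, (-1 : ℤ) ^ B.card * (Fintype.card F : ℤ) ^ (ℓ - r B) =
      ∏ j, ((Fintype.card F : ℤ) - d j) := by
  classical
  have hnp : NonProp Finset.univ D.a := by
    constructor
    · intro i _ h
      have := D.hb1 i i
      rw [h] at this; simp at this
    · intro i _ j _ hij c h
      have h1 := D.hb1 i j
      have h0 := D.hb0 i j hij
      rw [h] at h1
      simp only [Pi.smul_apply, smul_eq_mul, mul_assoc, ← Finset.mul_sum, h0, mul_zero] at h1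
      exact zero_ne_one h1
  let S : ι → Finset (Fin ℓ → F) := fun i => Finset.univ.filter fun v => ∑ t, D.a i t * v t = 0
  have hV := ff_count hnp (Matrix.of D.M) (fun j i _ => ⟨D.g i j, D.hM i j⟩)
    (c := D.c) (by intro h; have := D.hc; rw [h] at this; simp at this) D.hdet d D.hdeg
    (by rw [hsum]; rfl) hq (Finset.univ.inf fun i => (S i)ᶜ) (by
      intro v
      rw [Finset.mem_inf]; simp [S])
  have hie := Finset.inclusion_exclusion_card_inf_compl Finset.univ S
  rw [hV] at hie
  have hB : ∀ B : Finset ι, (B.inf S).card = Fintype.card F ^ (ℓ - r B) := by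
    intro B
    have h1 := (ker_rank (D.P B) (D.P' B) (D.Q B) (D.Q' B) (D.hP B) (D.hQ B)).2
    rw [← D.hPQ] at h1
    rw [← h1, ← Module.card_eq_pow_finrank (K := F), ← Fintype.card_coe]
    refine Fintype.card_congr (Equiv.subtypeEquivRight fun v => ?_)
    rw [Finset.mem_inf, LinearMap.mem_ker, funext_iff]
    simp only [S, Finset.mem_filter, Finset.mem_univ, true_and, Matrix.mulVecLin_apply,
      Matrix.mulVec, dotProduct, Matrix.of_apply, Pi.zero_apply, Subtype.forall]
  simp only [hB] at hie
  push_cast at hie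
  rw [Finset.powerset_univ] at hie
  rw [← hie]
  refine Finset.prod_congr rfl fun j _ => ?_
  rw [Nat.cast_sub (hq j).le]

theorem Cert.poly {R : Type} [CommRing R] [Nontrivial R] [Algebra.FiniteType ℤ R]
    (D : Cert R ι ℓ d r) (hsum : ∑ j, d j = Fintype.card ι) :
    ∑ B : Finset ι, Polynomial.C ((-1 : ℤ) ^ B.card) * Polynomial.X ^ (ℓ - r B) =
      ∏ j, (Polynomial.X - Polynomial.C (d j : ℤ)) := by
  apply Polynomial.eq_of_infinite_eval_eq
  apply Set.infinite_of_forall_exists_gt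
  intro n
  obtain ⟨F, _, _, hF, ⟨φ⟩⟩ := exists_hom R (n.toNat + ∑ j, d j + 1)
  have hq : ∀ j, d j < Fintype.card F := fun j => by
    have : d j ≤ ∑ j, d j := Finset.single_le_sum (fun _ _ => Nat.zero_le _) (Finset.mem_univ j)
    omega
  refine ⟨(Fintype.card F : ℤ), ?_, by omega⟩
  have := (D.map φ).count hsum hq
  simp only [Set.mem_ofPred_eq, Polynomial.eval_finsetSum, Polynomial.eval_mul, Polynomial.eval_C,
    Polynomial.eval_pow, Polynomial.eval_X, Polynomial.eval_prod, Polynomial.eval_sub]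
  exact this

end ArrAux

end

section

namespace ArrAux
open MvPolynomial
variable {ι : Type} [Fintype ι] {ℓ : ℕ} {d : Fin ℓ → ℕ} {r : Finset ι → ℕ}

theorem lift_poly {K : Type} [Field K] (R : Subalgebra ℤ K) (p : MvPolynomial (Fin ℓ) K)
    (h : (p.coeffs : Set K) ⊆ R) :
    ∃ p' : MvPolynomial (Fin ℓ) R, MvPolynomial.map (algebraMap R K) p' = p := by
  have := (mem_range_map_iff_coeffs_subset (f := algebraMap R K) (x := p)).2 (by
    intro x hx
    exact ⟨⟨x, h hx⟩, rfl⟩)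
  exact this

theorem Cert.descend {K : Type} [Field K] (D : Cert K ι ℓ d r) :
    ∃ R : Subalgebra ℤ K, Algebra.FiniteType ℤ R ∧ Nonempty (Cert R ι ℓ d r) := by
  classical
  let S1 : Set K := Set.range fun p : ι × Fin ℓ => D.a p.1 p.2
  let S2 : Set K := Set.range fun p : ι × ι × Fin ℓ => D.b p.1 p.2.1 p.2.2
  let S3 : Set K := {D.c, D.c'}
  let S4 : Set K := ⋃ p : Fin ℓ × Fin ℓ, ((D.M p.1 p.2).coeffs : Set K)
  let S5 : Set K := ⋃ p : ι × Fin ℓ, ((D.g p.1 p.2).coeffs : Set K)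
  let S6 : Set K := Set.range fun p : Σ B : Finset ι, B × Fin (r B) => D.P p.1 p.2.1 p.2.2
  let S7 : Set K := Set.range fun p : Σ B : Finset ι, Fin (r B) × B => D.P' p.1 p.2.1 p.2.2
  let S8 : Set K := Set.range fun p : Σ B : Finset ι, Fin (r B) × Fin ℓ => D.Q p.1 p.2.1 p.2.2
  let S9 : Set K := Set.range fun p : Σ B : Finset ι, Fin ℓ × Fin (r B) => D.Q' p.1 p.2.1 p.2.2
  let S : Set K := S1 ∪ (S2 ∪ (S3 ∪ (S4 ∪ (S5 ∪ (S6 ∪ (S7 ∪ (S8 ∪ S9)))))))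
  have hSf : S.Finite := Set.toFinite _
  have hft : Algebra.FiniteType ℤ (Algebra.adjoin ℤ S) := Algebra.FiniteType.adjoin_of_finite hSf
  have hSR : S ⊆ Algebra.adjoin ℤ S := Algebra.subset_adjoin
  refine ⟨Algebra.adjoin ℤ S, hft, ?_⟩
  generalize hRR : Algebra.adjoin ℤ S = R at hSR
  simp only [S, Set.union_subset_iff] at hSR
  obtain ⟨s1, s2, s3, s4, s5, s6, s7, s8, s9⟩ := hSR
  have e1 : ∀ i t, D.a i t ∈ R := fun i t => s1 ⟨(i, t), rfl⟩
  have e2 : ∀ i j t, D.b i j t ∈ R := fun i j t => s2 ⟨(i, j, t), rfl⟩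
  have e3 : D.c ∈ R := s3 (by simp [S3])
  have e3' : D.c' ∈ R := s3 (by simp [S3])
  have e4 : ∀ i j, ∃ p', MvPolynomial.map (algebraMap R K) p' = D.M i j := fun i j =>
    lift_poly R _ ((Set.subset_iUnion (fun p : Fin ℓ × Fin ℓ => ((D.M p.1 p.2).coeffs : Set K))
      (i, j)).trans s4)
  have e5 : ∀ i j, ∃ p', MvPolynomial.map (algebraMap R K) p' = D.g i j := fun i j =>
    lift_poly R _ ((Set.subset_iUnion (fun p : ι × Fin ℓ => ((D.g p.1 p.2).coeffs : Set K))
      (i, j)).trans s5)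
  have e6 : ∀ B x y, D.P B x y ∈ R := fun B x y => s6 ⟨⟨B, x, y⟩, rfl⟩
  have e7 : ∀ B x y, D.P' B x y ∈ R := fun B x y => s7 ⟨⟨B, x, y⟩, rfl⟩
  have e8 : ∀ B x y, D.Q B x y ∈ R := fun B x y => s8 ⟨⟨B, x, y⟩, rfl⟩
  have e9 : ∀ B x y, D.Q' B x y ∈ R := fun B x y => s9 ⟨⟨B, x, y⟩, rfl⟩
  choose M hM using e4
  choose g hg using e5
  have hinj : Function.Injective (algebraMap R K) := Subtype.val_injective
  have hinj' := MvPolynomial.map_injective (σ := Fin ℓ) _ hinj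
  have hminj : ∀ {m n : Type} (X Y : Matrix m n R), X.map (algebraMap R K) = Y.map (algebraMap R K)
      → X = Y := fun X Y h => Matrix.map_injective hinj h
  exact ⟨{
    a := fun i t => ⟨D.a i t, e1 i t⟩
    b := fun i j t => ⟨D.b i j t, e2 i j t⟩
    c := ⟨D.c, e3⟩
    c' := ⟨D.c', e3'⟩
    M := M
    g := g
    P := fun B => Matrix.of fun x y => ⟨D.P B x y, e6 B x y⟩
    P' := fun B => Matrix.of fun x y => ⟨D.P' B x y, e7 B x y⟩
    Q := fun B => Matrix.of fun x y => ⟨D.Q B x y, e8 B x y⟩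
    Q' := fun B => Matrix.of fun x y => ⟨D.Q' B x y, e9 B x y⟩
    hb1 := fun i j => hinj (by
      rw [map_sum, map_one]; exact D.hb1 i j)
    hb0 := fun i j h => hinj (by
      rw [map_sum, map_zero]; exact D.hb0 i j h)
    hc := hinj (by rw [map_mul, map_one]; exact D.hc)
    hM := fun i j => hinj' (by
      simp only [map_sum, map_mul, map_C, map_X, hM, hg]
      exact D.hM i j)
    hdet := hinj' (by
      simp only [RingHom.map_det, map_prod, map_sum, map_mul, map_C, map_X]
      rw [show (MvPolynomial.map (algebraMap R K)).mapMatrix (Matrix.of M) = Matrix.of D.M from by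
        ext1 i j; exact hM i j]
      exact D.hdet)
    hdeg := fun j i => by
      refine le_trans ?_ (D.hdeg j i)
      rw [← hM, totalDegree, totalDegree, support_map_of_injective _ hinj]
    hP := fun B => hminj _ _ (by
      rw [Matrix.map_mul, Matrix.map_one _ (map_zero _) (map_one _)]; exact D.hP B)
    hQ := fun B => hminj _ _ (by
      rw [Matrix.map_mul, Matrix.map_one _ (map_zero _) (map_one _)]; exact D.hQ B)
    hPQ := fun B => hminj _ _ (by
      rw [Matrix.map_mul]; exact D.hPQ B) }⟩

theorem exists_rank_cert {K : Type} [Field K] {β : Type} [Fintype β] [DecidableEq β]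
    (A : Matrix β (Fin ℓ) K) :
    ∃ (n : ℕ) (P : Matrix β (Fin n) K) (P' : Matrix (Fin n) β K) (Q : Matrix (Fin n) (Fin ℓ) K)
      (Q' : Matrix (Fin ℓ) (Fin n) K), P' * P = 1 ∧ Q * Q' = 1 ∧ A = P * Q := by
  let f := Matrix.toLin' A
  let n := Module.finrank K (LinearMap.range f)
  let E : LinearMap.range f ≃ₗ[K] (Fin n → K) := LinearEquiv.ofFinrankEq _ _ (by simp [n])
  let p : (Fin n → K) →ₗ[K] (β → K) := (LinearMap.range f).subtype ∘ₗ E.symm.toLinearMap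
  let q : (Fin ℓ → K) →ₗ[K] (Fin n → K) := E.toLinearMap ∘ₗ f.rangeRestrict
  obtain ⟨p', hp'⟩ := p.exists_leftInverse_of_injective (by
    rw [LinearMap.ker_eq_bot]
    exact (Subtype.val_injective).comp E.symm.injective)
  obtain ⟨q', hq'⟩ := q.exists_rightInverse_of_surjective (by
    rw [LinearMap.range_eq_top]
    exact E.surjective.comp f.surjective_rangeRestrict)
  refine ⟨n, LinearMap.toMatrix' p, LinearMap.toMatrix' p', LinearMap.toMatrix' q,
    LinearMap.toMatrix' q', ?_, ?_, ?_⟩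
  · rw [← LinearMap.toMatrix'_comp, hp', LinearMap.toMatrix'_id]
  · rw [← LinearMap.toMatrix'_comp, hq', LinearMap.toMatrix'_id]
  · rw [← LinearMap.toMatrix'_comp]
    have : p ∘ₗ q = f := by
      ext v : 1
      ext; simp [p, q]
    rw [this]; simp [f]

theorem exists_sep {K : Type} [Field K] {x y : Fin ℓ → K} (hx : x ≠ 0) (h : ∀ c : K, y ≠ c • x) :
    ∃ b : Fin ℓ → K, ∑ t, y t * b t = 1 ∧ ∑ t, x t * b t = 0 := by
  obtain ⟨t, ht⟩ : ∃ t, x t ≠ 0 := by by_contra! h; exact hx (funext h)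
  obtain ⟨u, hu⟩ : ∃ u, x t * y u - x u * y t ≠ 0 := by
    by_contra! h'
    refine h (y t / x t) (funext fun u => ?_)
    have := h' u
    simp only [Pi.smul_apply, smul_eq_mul]
    field_simp
    linear_combination this
  refine ⟨fun v => (x t * y u - x u * y t)⁻¹ *
    (x t * (Pi.single u 1 : Fin ℓ → K) v - x u * (Pi.single t 1 : Fin ℓ → K) v), ?_, ?_⟩
  · have : ∀ v, y v * ((x t * y u - x u * y t)⁻¹ *
      (x t * (Pi.single u 1 : Fin ℓ → K) v - x u * (Pi.single t 1 : Fin ℓ → K) v)) =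
      (x t * y u - x u * y t)⁻¹ * (x t * (y v * (Pi.single u 1 : Fin ℓ → K) v) -
        x u * (y v * (Pi.single t 1 : Fin ℓ → K) v)) := fun v => by ring
    simp only [this, ← Finset.mul_sum, Finset.sum_sub_distrib]
    simp only [Pi.single_apply, mul_ite, mul_one, mul_zero, Finset.sum_ite_eq', Finset.mem_univ,
      if_true]
    exact inv_mul_cancel₀ hu
  · have : ∀ v, x v * ((x t * y u - x u * y t)⁻¹ *
      (x t * (Pi.single u 1 : Fin ℓ → K) v - x u * (Pi.single t 1 : Fin ℓ → K) v)) =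
      (x t * y u - x u * y t)⁻¹ * (x t * (x v * (Pi.single u 1 : Fin ℓ → K) v) -
        x u * (x v * (Pi.single t 1 : Fin ℓ → K) v)) := fun v => by ring
    simp only [this, ← Finset.mul_sum, Finset.sum_sub_distrib]
    simp only [Pi.single_apply, mul_ite, mul_one, mul_zero, Finset.sum_ite_eq', Finset.mem_univ,
      if_true]
    ring

theorem exists_one {K : Type} [Field K] {x : Fin ℓ → K} (hx : x ≠ 0) :
    ∃ b : Fin ℓ → K, ∑ t, x t * b t = 1 := by
  obtain ⟨t, ht⟩ : ∃ t, x t ≠ 0 := by by_contra! h; exact hx (funext h)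
  exact ⟨Pi.single t (x t)⁻¹, by simp [Pi.single_apply, ht]⟩

/-- Terao's factorization, in terms of the Whitney sum -/
theorem terao {K : Type} [Field K] {a : ι → Fin ℓ → K} (h : NonProp Finset.univ a)
    (M : Matrix (Fin ℓ) (Fin ℓ) (MvPolynomial (Fin ℓ) K))
    (hM : ∀ j, Log Finset.univ a (M j)) {c : K} (hc : c ≠ 0)
    (hdet : M.det = C c * Qp Finset.univ a)
    (hd : ∀ j i, (M j i).totalDegree ≤ d j) (hsum : ∑ j, d j = Fintype.card ι) :
    ∑ B : Finset ι, Polynomial.C ((-1 : ℤ) ^ B.card) * Polynomial.X ^ (Module.finrank K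
      (LinearMap.ker (Matrix.of fun (i : B) t => a i t).mulVecLin)) =
      ∏ j, (Polynomial.X - Polynomial.C (d j : ℤ)) := by
  classical
  have hb : ∀ i j, ∃ b : Fin ℓ → K, ∑ t, a j t * b t = 1 ∧ (i ≠ j → ∑ t, a i t * b t = 0) := by
    intro i j
    by_cases hij : i = j
    · obtain ⟨b, hb⟩ := exists_one (h.1 j (Finset.mem_univ _))
      exact ⟨b, hb, fun h => absurd hij h⟩
    · obtain ⟨b, hb, hb'⟩ := exists_sep (h.1 i (Finset.mem_univ _))
        (h.2 i (Finset.mem_univ _) j (Finset.mem_univ _) hij)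
      exact ⟨b, hb, fun _ => hb'⟩
  choose b hb1 hb0 using hb
  have hg : ∀ i j, ∃ g, app (a i) (M j) = lin (a i) * g := fun i j => hM j i (Finset.mem_univ _)
  choose g hg using hg
  have hr := fun B : Finset ι => exists_rank_cert (Matrix.of fun (i : B) t => a i t)
  choose r P P' Q Q' hP hQ hPQ using hr
  let D : Cert K ι ℓ d r := {
    a := a, b := b, c := c, c' := c⁻¹, M := M, g := g, P := P, P' := P', Q := Q, Q' := Q'
    hb1 := hb1, hb0 := hb0, hc := mul_inv_cancel₀ hc, hM := hg, hdet := hdet, hdeg := hd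
    hP := hP, hQ := hQ, hPQ := hPQ }
  obtain ⟨R, hR, ⟨D'⟩⟩ := D.descend
  rw [← D'.poly hsum]
  refine Finset.sum_congr rfl fun B _ => ?_
  have := (ker_rank (P B) (P' B) (Q B) (Q' B) (hP B) (hQ B)).2
  rw [hPQ, this]

end ArrAux

end

section
namespace ArrAux
open MvPolynomial
variable {k : Type*} [Field k] {ℓ : ℕ}

theorem Log.det_dvd {ι : Type*} {s : Finset ι} {a : ι → Fin ℓ → k}
    (M N : Matrix (Fin ℓ) (Fin ℓ) (MvPolynomial (Fin ℓ) k))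
    (hgen : ∀ η, Log s a η → ∃ f : Fin ℓ → MvPolynomial (Fin ℓ) k, η = ∑ j, f j • M j)
    (hN : ∀ j, Log s a (N j)) : M.det ∣ N.det := by
  choose f hf using fun j => hgen _ (hN j)
  have : N = Matrix.of f * M := by
    ext1 i j
    rw [hf i, Matrix.mul_apply]
    simp
  rw [this, Matrix.det_mul]
  exact dvd_mul_left _ _

theorem exists_N {a : Fin ℓ → k} (ha : a ≠ 0) :
    ∃ (N : Matrix (Fin ℓ) (Fin ℓ) (MvPolynomial (Fin ℓ) k)) (c : k), c ≠ 0 ∧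
      N.det = lin a * C c ∧ ∀ j, lin a ∣ app a (N j) := by
  obtain ⟨i, hi⟩ : ∃ i, a i ≠ 0 := by by_contra! h; exact ha (funext h)
  let v : Fin ℓ → MvPolynomial (Fin ℓ) k := fun t =>
    if t = i then lin a * C (a i)⁻¹ else - C (a t * (a i)⁻¹)
  refine ⟨Matrix.updateCol 1 i v, (a i)⁻¹, inv_ne_zero hi, ?_, ?_⟩
  · rw [← Matrix.cramer_apply, Matrix.cramer_one]; simp [v]
  · intro j
    have hC : (C (a i) * C (a i)⁻¹ : MvPolynomial (Fin ℓ) k) = 1 := by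
      rw [← C_mul, mul_inv_cancel₀ hi, C_1]
    by_cases hj : j = i
    · subst hj
      have : app (a := a) (Matrix.updateCol 1 j v j) = lin a := by
        unfold app
        rw [Finset.sum_eq_single j]
        · simp only [Matrix.updateCol_self, v, if_true]
          linear_combination (lin a) * hC
        · intro b _ hb
          rw [Matrix.updateCol_ne hb, Matrix.one_apply_ne (Ne.symm hb), mul_zero]
        · simp
      rw [this]
    · have : app (a := a) (Matrix.updateCol 1 i v j) = 0 := by
        unfold app
        rw [← Finset.add_sum_erase _ _ (Finset.mem_univ i),
          Finset.sum_eq_single_of_mem j (by simp [hj])]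
        · rw [Matrix.updateCol_ne hj, Matrix.updateCol_self, Matrix.one_apply_eq]
          simp only [v, if_neg hj, C_mul]
          linear_combination (- C (a j)) * hC
        · intro b hb hbj
          rw [Matrix.updateCol_ne (Finset.ne_of_mem_erase hb), Matrix.one_apply_ne (Ne.symm hbj),
            mul_zero]
      rw [this]; exact dvd_zero _

theorem det_ne_zero_of_indep (M : Matrix (Fin ℓ) (Fin ℓ) (MvPolynomial (Fin ℓ) k))
    (hind : ∀ f : Fin ℓ → MvPolynomial (Fin ℓ) k, ∑ j, f j • M j = 0 → ∀ j, f j = 0) :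
    M.det ≠ 0 := by
  intro h0
  obtain ⟨v, hv, hv0⟩ := Matrix.exists_vecMul_eq_zero_iff.2 h0
  apply hv
  funext j
  refine hind v ?_ j
  rw [← hv0]
  funext i
  simp [Matrix.vecMul, dotProduct]

theorem saito_fwd {ι : Type*} {s : Finset ι} {a : ι → Fin ℓ → k} (h : NonProp s a)
    (M : Matrix (Fin ℓ) (Fin ℓ) (MvPolynomial (Fin ℓ) k)) (hM : ∀ j, Log s a (M j))
    (hgen : ∀ η, Log s a η → ∃ f : Fin ℓ → MvPolynomial (Fin ℓ) k, η = ∑ j, f j • M j)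
    (hind : ∀ f : Fin ℓ → MvPolynomial (Fin ℓ) k, ∑ j, f j • M j = 0 → ∀ j, f j = 0) :
    ∃ c : k, c ≠ 0 ∧ M.det = C c * Qp s a := by
  classical
  have hdet := det_ne_zero_of_indep M hind
  obtain ⟨u, hu⟩ := Qp_dvd_det h M hM
  have hu0 : u ≠ 0 := by rintro rfl; rw [mul_zero] at hu; exact hdet hu
  have hQ := Qp_ne_zero h
  have h1 : u ∣ Qp s a ^ ℓ := by
    have := Log.det_dvd M (Qp s a • (1 : Matrix _ _ _)) hgen (fun j i hi => by
      rw [show (Qp s a • (1 : Matrix (Fin ℓ) (Fin ℓ) (MvPolynomial (Fin ℓ) k))) j =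
        Qp s a • ((1 : Matrix (Fin ℓ) (Fin ℓ) (MvPolynomial (Fin ℓ) k)) j) from rfl, app_smul]
      exact (Finset.dvd_prod_of_mem (fun i => lin (a i)) hi).mul_right _)
    rw [Matrix.det_smul, Matrix.det_one, mul_one, Fintype.card_fin, hu] at this
    exact (dvd_mul_left _ _).trans this
  have h2 : ∀ i ∈ s, u ∣ (∏ j ∈ s.erase i, lin (a j)) ^ ℓ := by
    intro i hi
    obtain ⟨N, c, hc, hN, hNl⟩ := exists_N (h.1 i hi)
    set q := ∏ j ∈ s.erase i, lin (a j) with hq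
    have hqQ : Qp s a = lin (a i) * q := (Finset.mul_prod_erase _ _ hi).symm
    have := Log.det_dvd M (q • N) hgen (fun j t ht => by
      rw [show (q • N) j = q • (N j) from rfl, app_smul]
      by_cases hti : t = i
      · subst hti; exact (hNl j).mul_left _
      · exact (Finset.dvd_prod_of_mem (fun i => lin (a i))
          (Finset.mem_erase.2 ⟨hti, ht⟩)).mul_right _)
    rw [Matrix.det_smul, Fintype.card_fin, hu, hN, hqQ] at this
    have hc1 : (C c⁻¹ * C c : MvPolynomial (Fin ℓ) k) = 1 := by
      rw [← C_mul, inv_mul_cancel₀ hc, C_1]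
    have h3 : lin (a i) * (q * u) ∣ lin (a i) * (q ^ ℓ) := by
      obtain ⟨w, hw⟩ := this
      exact ⟨w * C c⁻¹, by linear_combination (C c⁻¹) * hw - (lin (a i) * q ^ ℓ) * hc1⟩
    exact (dvd_mul_left _ _).trans ((mul_dvd_mul_iff_left (lin_ne_zero (h.1 i hi))).1 h3)
  have hunit : IsUnit u := by
    by_contra hnu
    obtain ⟨p, hp, hpu⟩ := WfDvdMonoid.exists_irreducible_factor hnu hu0
    have hpp := hp.prime
    obtain ⟨i, hi, hpi⟩ := hpp.exists_mem_finset_dvd (hpp.dvd_of_dvd_pow (hpu.trans h1))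
    obtain ⟨j, hj, hpj⟩ := hpp.exists_mem_finset_dvd (hpp.dvd_of_dvd_pow (hpu.trans (h2 i hi)))
    exact hpp.not_isUnit (h.relPrime hi (Finset.mem_of_mem_erase hj)
      (Finset.ne_of_mem_erase hj).symm hpi hpj)
  obtain ⟨c, hc, hcu⟩ := (MvPolynomial.isUnit_iff_eq_C_of_isReduced).1 hunit
  exact ⟨c, hc.ne_zero, by rw [hu, ← hcu, mul_comm]⟩

theorem det_homog (M : Matrix (Fin ℓ) (Fin ℓ) (MvPolynomial (Fin ℓ) k)) (e : Fin ℓ → ℕ)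
    (hM : ∀ j i, (M j i).IsHomogeneous (e j)) : M.det.IsHomogeneous (∑ j, e j) := by
  rw [← Matrix.det_transpose, Matrix.det_apply]
  refine IsHomogeneous.sum _ _ _ fun σ _ => ?_
  have := IsHomogeneous.prod Finset.univ (fun i => M i (σ i)) e fun i _ => hM _ _
  rcases Int.units_eq_one_or (Equiv.Perm.sign σ) with h | h
  · rw [h, one_smul]; exact this
  · rw [h, Units.neg_smul, one_smul]; exact this.neg

theorem saito_degree {ι : Type*} {s : Finset ι} {a : ι → Fin ℓ → k} (h : NonProp s a)
    (M : Matrix (Fin ℓ) (Fin ℓ) (MvPolynomial (Fin ℓ) k)) (e : Fin ℓ → ℕ)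
    (hM : ∀ j i, (M j i).IsHomogeneous (e j)) {c : k} (hc : c ≠ 0)
    (hdet : M.det = C c * Qp s a) : ∑ j, e j = s.card := by
  have h1 := det_homog M e hM
  have h2 : (C c * Qp s a).IsHomogeneous (0 + s.card) := (isHomogeneous_C _ _).mul Qp_homog
  rw [hdet] at h1
  have := h1.inj_right h2 (mul_ne_zero (by simpa using hc) (Qp_ne_zero h))
  omega

/-- converse by degrees -/
theorem saito_of_degree {ι : Type*} {s : Finset ι} {a : ι → Fin ℓ → k} (h : NonProp s a)
    (M : Matrix (Fin ℓ) (Fin ℓ) (MvPolynomial (Fin ℓ) k)) (e : Fin ℓ → ℕ)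
    (hM : ∀ j i, (M j i).IsHomogeneous (e j)) (hlog : ∀ j, Log s a (M j))
    (hdet : M.det ≠ 0) (hdeg : ∑ j, e j = s.card) : ∃ c : k, c ≠ 0 ∧ M.det = C c * Qp s a := by
  obtain ⟨u, hu⟩ := Qp_dvd_det h M hlog
  have hu0 : u ≠ 0 := by rintro rfl; rw [mul_zero] at hu; exact hdet hu
  have h1 := (det_homog M e hM).totalDegree hdet
  rw [hu, totalDegree_mul_of_isDomain (Qp_ne_zero h) hu0, Qp_homog.totalDegree (Qp_ne_zero h)] at h1
  have h2 := (totalDegree_eq_zero_iff_eq_C (p := u)).1 (by omega)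
  refine ⟨u.coeff 0, ?_, ?_⟩
  · intro h; rw [h] at h2; exact hu0 (by simpa using h2)
  · rw [hu, mul_comm, ← h2]
end ArrAux

end

section
namespace ArrAux
open MvPolynomial
section
variable {k : Type} [Field k] {ℓ : ℕ}

theorem hc_shift (T : MvPolynomial (Fin ℓ) k →ₗ[k] MvPolynomial (Fin ℓ) k) (m : ℕ)
    (hT : ∀ n p, p.IsHomogeneous n → (T p).IsHomogeneous (n + m)) (n : ℕ) (p) :
    homogeneousComponent (n + m) (T p) = T (homogeneousComponent n p) := by
  conv_lhs => rw [← sum_homogeneousComponent p, map_sum, map_sum]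
  have : ∀ i, homogeneousComponent (n + m) (T (homogeneousComponent i p)) =
      if i = n then T (homogeneousComponent i p) else 0 := by
    intro i
    rw [homogeneousComponent_of_mem (hT i _ (homogeneousComponent_isHomogeneous i p))]
    by_cases h : i = n
    · simp [h]
    · rw [if_neg h, if_neg (by omega)]
  simp only [this, Finset.sum_ite_eq', Finset.mem_range]
  split_ifs with h
  · rfl
  · rw [homogeneousComponent_eq_zero _ _ (by omega), map_zero]

theorem hc_mul (g : MvPolynomial (Fin ℓ) k) (m : ℕ) (hg : g.IsHomogeneous m) (n : ℕ) (p) :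
    homogeneousComponent (n + m) (p * g) = homogeneousComponent n p * g :=
  hc_shift (LinearMap.mulRight k g) m (fun _ _ h => h.mul hg) n p

/-- projection modulo a linear form -/
structure Proj (α : Fin ℓ → k) (π : MvPolynomial (Fin ℓ) k →ₐ[k] MvPolynomial (Fin ℓ) k) : Prop where
  ne : α ≠ 0
  ker : π (lin α) = 0
  sub : ∀ p, lin α ∣ p - π p
  hom : ∀ n p, p.IsHomogeneous n → (π p).IsHomogeneous n
  plin : ∀ b, ∃ c : k, π (lin b) = lin (b - c • α)

theorem exists_proj {α : Fin ℓ → k} (hα : α ≠ 0) : ∃ π, Proj α π := by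
  obtain ⟨i, hi⟩ : ∃ i, α i ≠ 0 := by by_contra! h; exact hα (funext h)
  let v : Fin ℓ → MvPolynomial (Fin ℓ) k := fun t =>
    X t - (if t = i then C (α i)⁻¹ * lin α else 0)
  have hv : ∀ t, (v t).IsHomogeneous 1 := by
    intro t
    refine (isHomogeneous_X _ _).sub ?_
    split_ifs
    · simpa using (isHomogeneous_C _ (α i)⁻¹).mul (lin_homog α)
    · exact isHomogeneous_zero _ _ _
  have hlin : ∀ b : Fin ℓ → k, aeval v (ArrAux.lin b) = ArrAux.lin (b - (b i * (α i)⁻¹) • α) := by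
    intro b
    rw [lin_sub, lin_smul]
    simp only [ArrAux.lin, map_sum, map_mul, aeval_X, algHom_C]
    simp only [v, mul_sub, Finset.sum_sub_distrib, mul_ite, mul_zero, Finset.sum_ite_eq',
      Finset.mem_univ, if_true, algebraMap_eq]
    rw [mul_assoc]; rfl
  refine ⟨aeval v, hα, ?_, ?_, ?_, fun b => ⟨_, hlin b⟩⟩
  · rw [hlin, mul_inv_cancel₀ hi, one_smul, sub_self, lin_zero]
  · intro p
    induction p using MvPolynomial.induction_on with
    | C a => simp
    | add p q hp hq =>
      rw [map_add, add_sub_add_comm]; exact dvd_add hp hq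
    | mul_X p t hp =>
      have h2 : ArrAux.lin α ∣ X t - v t := by
        simp only [v, sub_sub_cancel]
        split_ifs
        · exact dvd_mul_left _ _
        · exact dvd_zero _
      rw [map_mul, aeval_X]
      have : p * X t - aeval v p * v t = (p - aeval v p) * X t + aeval v p * (X t - v t) := by ring
      rw [this]; exact dvd_add (hp.mul_right _) (h2.mul_left _)
  · intro n p hp
    simpa using hp.aeval v hv

namespace Proj
variable {α : Fin ℓ → k} {π : MvPolynomial (Fin ℓ) k →ₐ[k] MvPolynomial (Fin ℓ) k}

theorem dvd_iff (P : Proj α π) (p) : ArrAux.lin α ∣ p ↔ π p = 0 := by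
  constructor
  · rintro ⟨q, rfl⟩; rw [map_mul, P.ker, zero_mul]
  · intro h; have := P.sub p; rwa [h, sub_zero] at this

theorem idem (P : Proj α π) (p) : π (π p) = π p := by
  have := (P.dvd_iff _).1 (P.sub p)
  rw [map_sub, sub_eq_zero] at this; exact this.symm

end Proj

/-- restriction data -/
structure Res {ι : Type} (s R : Finset ι) (a : ι → Fin ℓ → k) (r : ι → ι) (α : Fin ℓ → k)
    (π : MvPolynomial (Fin ℓ) k →ₐ[k] MvPolynomial (Fin ℓ) k) : Prop where
  P : Proj α π
  np : NonProp s a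
  npα : ∀ i ∈ s, ∀ c : k, a i ≠ c • α
  RS : R ⊆ s
  rR : ∀ i ∈ s, r i ∈ R
  rr : ∀ i ∈ R, r i = i
  rel : ∀ i ∈ s, ∃ c c' : k, c ≠ 0 ∧ a i = c • a (r i) + c' • α
  nrel : ∀ i ∈ R, ∀ j ∈ R, i ≠ j → ∀ c c' : k, a j ≠ c • a i + c' • α

theorem lin_add (a b : Fin ℓ → k) : lin (a + b) = lin a + lin b := by
  simp [lin, add_mul, Finset.sum_add_distrib]

theorem app_add' (a b : Fin ℓ → k) (θ) : app (a + b) θ = app a θ + app b θ := by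
  simp [app, add_mul, Finset.sum_add_distrib]

namespace Res
variable {ι : Type} [DecidableEq ι] {s R : Finset ι} {a : ι → Fin ℓ → k} {r : ι → ι} {α : Fin ℓ → k}
  {π : MvPolynomial (Fin ℓ) k →ₐ[k] MvPolynomial (Fin ℓ) k}

theorem pne (D : Res s R a r α π) {i} (hi : i ∈ s) : π (lin (a i)) ≠ 0 := by
  obtain ⟨c, hc⟩ := D.P.plin (a i)
  rw [hc]
  exact lin_ne_zero (sub_ne_zero.2 (D.npα i hi c))

theorem pne' (D : Res s R a r α π) {t : Finset ι} (ht : t ⊆ s) : ∏ i ∈ t, π (lin (a i)) ≠ 0 :=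
  Finset.prod_ne_zero_iff.2 fun _ hi => D.pne (ht hi)

theorem prel (D : Res s R a r α π) {i} (hi : i ∈ s) :
    ∃ c : k, c ≠ 0 ∧ π (lin (a i)) = C c * π (lin (a (r i))) := by
  obtain ⟨c, c', hc, h⟩ := D.rel i hi
  refine ⟨c, hc, ?_⟩
  rw [h, lin_add, lin_smul, lin_smul, map_add, map_mul, map_mul, D.P.ker, mul_zero, add_zero,
    algHom_C, algebraMap_eq]

theorem relR (D : Res s R a r α π) {i j} (hi : i ∈ R) (hj : j ∈ R) (h : i ≠ j) :
    IsRelPrime (π (lin (a i))) (π (lin (a j))) := by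
  obtain ⟨c, hc⟩ := D.P.plin (a i)
  obtain ⟨c', hc'⟩ := D.P.plin (a j)
  rw [hc, hc']
  refine lin_relPrime (sub_ne_zero.2 (D.npα i (D.RS hi) c)) (sub_ne_zero.2 (D.npα j (D.RS hj) c'))
    fun x hx => D.nrel i hi j hj h x (c' - x * c) ?_
  rw [sub_eq_iff_eq_add] at hx
  rw [hx, smul_sub, sub_smul, mul_smul]; abel

theorem relS (D : Res s R a r α π) {i j} (hi : i ∈ s) (hj : j ∈ s) (h : r i ≠ r j) :
    IsRelPrime (π (lin (a i))) (π (lin (a j))) := by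
  obtain ⟨c, hc, h1⟩ := D.prel hi
  obtain ⟨c', hc', h2⟩ := D.prel hj
  rw [h1, h2, isRelPrime_mul_unit_left_left ((isUnit_iff_ne_zero.2 hc).map C),
    isRelPrime_mul_unit_left_right ((isUnit_iff_ne_zero.2 hc').map C)]
  exact D.relR (D.rR i hi) (D.rR j hj) h

theorem bb_dvd (D : Res s R a r α π) {θ} (hθ : Log s a θ) :
    ∏ i ∈ s \ R, π (lin (a i)) ∣ π (app α θ) := by
  rw [← Finset.prod_fiberwise_of_maps_to (s := s \ R) (t := R) (g := r)
    (fun i hi => D.rR i (Finset.mem_sdiff.1 hi).1)]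
  refine Finset.prod_dvd_of_isRelPrime (fun i _ j _ hij => ?_) fun t ht => ?_
  · refine IsRelPrime.prod_left fun x hx => IsRelPrime.prod_right fun y hy => ?_
    simp only [Finset.mem_filter, Finset.mem_sdiff] at hx hy
    exact D.relS hx.1.1 hy.1.1 (by rw [hx.2, hy.2]; exact hij)
  · have hts := D.RS ht
    have h1 : ∀ i ∈ s.filter (fun i => r i = t),
        lin (a i) ∣ lin (a t) * app α θ - lin α * app (a t) θ := by
      intro i hi
      rw [Finset.mem_filter] at hi
      obtain ⟨c, c', hc, h⟩ := D.rel i hi.1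
      rw [hi.2] at h
      have e1 : lin (a i) = C c * lin (a t) + C c' * lin α := by
        rw [h, lin_add, lin_smul, lin_smul]
      have e2 : app (a i) θ = C c * app (a t) θ + C c' * app α θ := by
        rw [h, app_add', app_smul', app_smul']
      have hC : (C c⁻¹ * C c : MvPolynomial (Fin ℓ) k) = 1 := by
        rw [← C_mul, inv_mul_cancel₀ hc, C_1]
      obtain ⟨w, hw⟩ := hθ i hi.1
      refine ⟨C c⁻¹ * (app α θ - lin α * w), ?_⟩
      linear_combination (-C c⁻¹ * app α θ) * e1 - C c⁻¹ * lin α * hw + C c⁻¹ * lin α * e2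
        - (lin (a t) * app α θ - lin α * app (a t) θ) * hC
    have h2 : ∏ i ∈ s.filter (fun i => r i = t), lin (a i) ∣
        lin (a t) * app α θ - lin α * app (a t) θ :=
      Finset.prod_dvd_of_isRelPrime (fun i hi j hj hij => D.np.relPrime
        (Finset.mem_filter.1 hi).1 (Finset.mem_filter.1 hj).1 hij) h1
    have h3 := map_dvd π h2
    rw [map_sub, map_mul, map_mul, D.P.ker, zero_mul, sub_zero, map_prod] at h3
    have htm : t ∈ s.filter (fun i => r i = t) := Finset.mem_filter.2 ⟨hts, D.rr t ht⟩
    rw [← Finset.mul_prod_erase _ _ htm, mul_dvd_mul_iff_left (D.pne hts)] at h3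
    have : (s \ R).filter (fun i => r i = t) = (s.filter (fun i => r i = t)).erase t := by
      ext i
      simp only [Finset.mem_filter, Finset.mem_sdiff, Finset.mem_erase]
      constructor
      · rintro ⟨⟨h1, h2⟩, h3⟩
        exact ⟨fun h => h2 (h ▸ ht), h1, h3⟩
      · rintro ⟨h1, h2, h3⟩
        exact ⟨⟨h2, fun h => h1 ((D.rr i h).symm.trans h3)⟩, h3⟩
    rw [this]; exact h3

theorem bb_homog (D : Res s R a r α π) :
    (∏ i ∈ s \ R, π (lin (a i))).IsHomogeneous (s \ R).card := by
  have := IsHomogeneous.prod (s \ R) (fun i => π (lin (a i))) (fun _ => 1)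
    fun i _ => D.P.hom _ _ (lin_homog _)
  simpa using this

theorem app_homog {θ : Fin ℓ → MvPolynomial (Fin ℓ) k} {n : ℕ} (b : Fin ℓ → k)
    (h : ∀ i, (θ i).IsHomogeneous n) : (app b θ).IsHomogeneous n :=
  IsHomogeneous.sum _ _ _ fun i _ => by
    simpa using (isHomogeneous_C _ (b i)).mul (h i)

/-- part C core -/
theorem low_deg (D : Res s R a r α π) {θ} (hθ : Log s a θ) {n : ℕ}
    (h : ∀ i, (θ i).IsHomogeneous n) (hn : n < (s \ R).card) : lin α ∣ app α θ := by
  rw [D.P.dvd_iff]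
  by_contra h0
  have h1 := D.bb_dvd hθ
  have h2 := totalDegree_le_of_dvd_of_isDomain h1 h0
  rw [D.bb_homog.totalDegree (D.pne' Finset.sdiff_subset),
    (D.P.hom _ _ (app_homog α h)).totalDegree h0] at h2
  omega
end Res
end
end ArrAux

end

section
namespace ArrAux
open MvPolynomial
namespace Res
set_option linter.unusedSectionVars false
variable {k : Type} [Field k] {ℓ : ℕ} {ι : Type} [DecidableEq ι] {s R : Finset ι}
  {a : ι → Fin ℓ → k} {r : ι → ι} {α : Fin ℓ → k}
  {π : MvPolynomial (Fin ℓ) k →ₐ[k] MvPolynomial (Fin ℓ) k}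

/-- the derivations `ψ_t` -/
theorem exists_psi (D : Res s R a r α π) {t} (ht : t ∈ s) :
    ∃ ψ : Fin ℓ → MvPolynomial (Fin ℓ) k, Log s a ψ ∧ app α ψ = ∏ i ∈ s.erase t, lin (a i) := by
  obtain ⟨v, hv1, hv0⟩ := exists_sep (x := a t) (y := α) (D.np.1 t ht) (by
    intro c hc
    have hc0 : c ≠ 0 := by rintro rfl; exact D.P.ne (by rw [hc, zero_smul])
    exact D.npα t ht c⁻¹ (by rw [hc, smul_smul, inv_mul_cancel₀ hc0, one_smul]))
  have key : ∀ b : Fin ℓ → k, app b (fun i => C (v i)) = C (∑ i, b i * v i) := by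
    intro b; simp [app]
  refine ⟨(∏ i ∈ s.erase t, lin (a i)) • fun i => C (v i), ?_, ?_⟩
  · intro i hi
    rw [app_smul, key]
    by_cases hit : i = t
    · subst hit; rw [hv0]; simp
    · exact (Finset.dvd_prod_of_mem (fun i => lin (a i))
        (Finset.mem_erase.2 ⟨hit, hi⟩)).mul_right _
  · rw [app_smul, key, hv1]; simp

theorem alpha_ndvd (D : Res s R a r α π) {t : Finset ι} (ht : t ⊆ s) :
    ¬ lin α ∣ ∏ i ∈ t, π (lin (a i)) := by
  rw [D.P.dvd_iff, map_prod]
  simp only [D.P.idem]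
  exact D.pne' ht

theorem log_cancel (D : Res s R a r α π) {θ} (h : Log s a (lin α • θ)) : Log s a θ := by
  intro i hi
  have := h i hi
  rw [app_smul] at this
  refine ((lin_prime (D.np.1 i hi)).dvd_or_dvd this).resolve_left fun h1 => ?_
  obtain ⟨c, hc, h2⟩ := lin_dvd D.P.ne h1
  exact D.npα i hi c⁻¹ (by rw [h2, smul_smul, inv_mul_cancel₀ hc, one_smul])

theorem exists_phi (D : Res s R a r α π) (hR : R.Nonempty)
    (M : Fin ℓ → Fin ℓ → MvPolynomial (Fin ℓ) k)
    (hM : ∀ j, Log s a (M j) ∧ lin α ∣ app α (M j))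
    (hgen : ∀ η, Log s a η → lin α ∣ app α η →
      ∃ f : Fin ℓ → MvPolynomial (Fin ℓ) k, η = ∑ j, f j • M j)
    (hind : ∀ f : Fin ℓ → MvPolynomial (Fin ℓ) k, ∑ j, f j • M j = 0 → ∀ j, f j = 0) :
    ∃ (φ : Fin ℓ → MvPolynomial (Fin ℓ) k) (c : Fin ℓ → MvPolynomial (Fin ℓ) k),
      lin α • φ = ∑ j, c j • M j ∧ π (app α φ) = ∏ i ∈ s \ R, π (lin (a i)) := by
  have hα0 := lin_ne_zero D.P.ne
  have h1 : ∀ t : ι, ∃ (ψ : Fin ℓ → MvPolynomial (Fin ℓ) k) (n : Fin ℓ → MvPolynomial (Fin ℓ) k),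
      t ∈ s → Log s a ψ ∧ app α ψ = ∏ i ∈ s.erase t, lin (a i) ∧ lin α • ψ = ∑ j, n j • M j := by
    intro t
    by_cases ht : t ∈ s
    · obtain ⟨ψ, hψ, h⟩ := D.exists_psi ht
      obtain ⟨n, hn⟩ := hgen (lin α • ψ) (hψ.smul _) (by rw [app_smul]; exact dvd_mul_right _ _)
      exact ⟨ψ, n, fun _ => ⟨hψ, h, hn⟩⟩
    · exact ⟨0, 0, fun h => absurd h ht⟩
  choose ψ n hψn using h1
  have h2 : ∀ t ∈ s, ∀ t' ∈ s, ∀ j,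
      π (lin (a t)) * π (n t j) = π (lin (a t')) * π (n t' j) := by
    intro t ht t' ht' j
    obtain ⟨l1, p1, q1⟩ := hψn t ht
    obtain ⟨l2, p2, q2⟩ := hψn t' ht'
    obtain ⟨m, hm⟩ := hgen (lin (a t) • ψ t - lin (a t') • ψ t') ((l1.smul _).sub (l2.smul _)) (by
      rw [app_sub, app_smul, app_smul, p1, p2, Finset.mul_prod_erase s (fun i => lin (a i)) ht,
        Finset.mul_prod_erase s (fun i => lin (a i)) ht', sub_self]
      exact dvd_zero _)
    have h3 := hind (fun j => lin (a t) * n t j - lin (a t') * n t' j - lin α * m j) (by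
      simp only [sub_smul, mul_smul, Finset.sum_sub_distrib, ← Finset.smul_sum]
      rw [← q1, ← q2, ← hm, smul_sub, smul_comm (lin α), smul_comm (lin α)]
      abel) j
    have h4 := congrArg π h3
    simp only [map_sub, map_mul, D.P.ker, zero_mul, sub_zero, map_zero] at h4
    exact sub_eq_zero.1 h4
  obtain ⟨t, ht⟩ := hR
  have hts := D.RS ht
  obtain ⟨l1, p1, q1⟩ := hψn t hts
  set p := ∏ i ∈ R.erase t, π (lin (a i)) with hp
  have hsub : R.erase t ⊆ s := (Finset.erase_subset _ _).trans D.RS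
  have h3 : ∀ j, p ∣ π (n t j) := by
    intro j
    refine Finset.prod_dvd_of_isRelPrime (fun x hx y hy hxy => D.relR (Finset.mem_of_mem_erase hx)
      (Finset.mem_of_mem_erase hy) hxy) fun x hx => ?_
    have h4 : π (lin (a x)) ∣ π (lin (a t)) * π (n t j) :=
      ⟨_, h2 t hts x (D.RS (Finset.mem_of_mem_erase hx)) j⟩
    exact (D.relR (Finset.mem_of_mem_erase hx) ht (Finset.ne_of_mem_erase hx)).dvd_of_dvd_mul_left h4
  choose c hc using h3
  choose w hw using fun j => D.P.sub (n t j)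
  -- P φ̂ = α (ψ - Σ w M)
  have h5 : p • ∑ j, c j • M j = lin α • (ψ t - ∑ j, w j • M j) := by
    rw [smul_sub, q1, Finset.smul_sum, Finset.smul_sum, ← Finset.sum_sub_distrib]
    refine Finset.sum_congr rfl fun j _ => ?_
    rw [smul_smul, smul_smul, ← sub_smul, ← hw, ← hc, sub_sub_cancel]
  have hpn := D.alpha_ndvd hsub
  have h6 : ∀ i, lin α ∣ (∑ j, c j • M j) i := by
    intro i
    have := congrFun h5 i
    simp only [Pi.smul_apply, smul_eq_mul] at this
    exact ((lin_prime D.P.ne).dvd_or_dvd ⟨_, this⟩).resolve_left hpn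
  choose φ hφ using h6
  have h7 : lin α • φ = ∑ j, c j • M j := by
    funext i; rw [hφ i]; rfl
  refine ⟨φ, c, h7, ?_⟩
  have h8 : p • φ = ψ t - ∑ j, w j • M j := by
    have : lin α • (p • φ) = lin α • (ψ t - ∑ j, w j • M j) := by
      rw [smul_comm, h7, h5]
    funext i
    exact mul_left_cancel₀ hα0 (congrFun this i)
  have h9 := congrArg (fun x => π (app α x)) h8
  simp only [app_sub, app_smul, app_sum, map_sub, map_mul, map_sum, p1] at h9
  rw [Finset.sum_eq_zero (fun j _ => by rw [(D.P.dvd_iff _).1 (hM j).2, mul_zero]), sub_zero] at h9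
  have hpp : π p = p := by rw [hp, map_prod]; simp only [D.P.idem]
  have hun : s.erase t = R.erase t ∪ (s \ R) := by
    ext i
    simp only [Finset.mem_erase, Finset.mem_union, Finset.mem_sdiff]
    constructor
    · rintro ⟨h1, h2⟩
      by_cases hi : i ∈ R
      · exact Or.inl ⟨h1, hi⟩
      · exact Or.inr ⟨h2, hi⟩
    · rintro (⟨h1, h2⟩ | ⟨h1, h2⟩)
      · exact ⟨h1, D.RS h2⟩
      · exact ⟨fun h => h2 (h ▸ ht), h1⟩
  rw [hpp, map_prod, hun, Finset.prod_union
    (Finset.disjoint_sdiff.mono_left (Finset.erase_subset _ _))] at h9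
  exact mul_left_cancel₀ (D.pne' hsub) h9

theorem exists_phi_homog (D : Res s R a r α π) (hR : R.Nonempty)
    (M : Fin ℓ → Fin ℓ → MvPolynomial (Fin ℓ) k) (e : Fin ℓ → ℕ)
    (hMh : ∀ j i, (M j i).IsHomogeneous (e j)) (he : ∀ j, e j < (s \ R).card)
    (hM : ∀ j, Log s a (M j) ∧ lin α ∣ app α (M j))
    (hgen : ∀ η, Log s a η → lin α ∣ app α η →
      ∃ f : Fin ℓ → MvPolynomial (Fin ℓ) k, η = ∑ j, f j • M j)
    (hind : ∀ f : Fin ℓ → MvPolynomial (Fin ℓ) k, ∑ j, f j • M j = 0 → ∀ j, f j = 0) :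
    ∃ (φ : Fin ℓ → MvPolynomial (Fin ℓ) k) (c : Fin ℓ → MvPolynomial (Fin ℓ) k),
      lin α • φ = ∑ j, c j • M j ∧ π (app α φ) = ∏ i ∈ s \ R, π (lin (a i)) ∧
      (∀ i, (φ i).IsHomogeneous (s \ R).card) ∧
      (∀ j, (c j).IsHomogeneous ((s \ R).card + 1 - e j)) ∧ Log s a φ := by
  obtain ⟨φ, c, h1, h2⟩ := D.exists_phi hR M hM hgen hind
  set d := (s \ R).card with hd
  have h3 : lin α • (fun i => homogeneousComponent d (φ i)) =
      ∑ j, homogeneousComponent (d + 1 - e j) (c j) • M j := by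
    funext i
    have := congrArg (homogeneousComponent (d + 1)) (congrFun h1 i)
    simp only [Pi.smul_apply, smul_eq_mul, Finset.sum_apply, map_sum] at this ⊢
    rw [mul_comm, ← hc_mul _ _ (lin_homog α), mul_comm, this]
    refine Finset.sum_congr rfl fun j _ => ?_
    rw [← hc_mul _ _ (hMh j i), show d + 1 - e j + e j = d + 1 by have := he j; omega]
  refine ⟨_, _, h3, ?_, fun i => homogeneousComponent_isHomogeneous _ _,
    fun j => homogeneousComponent_isHomogeneous _ _, D.log_cancel ?_⟩
  · have h4 : app α (fun i => homogeneousComponent d (φ i)) = homogeneousComponent d (app α φ) := by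
      simp [app, map_sum, homogeneousComponent_C_mul]
    have h5 := hc_shift π.toLinearMap 0 (fun n p h => D.P.hom n p h) d (app α φ)
    simp only [add_zero, AlgHom.toLinearMap_apply] at h5
    rw [h4, ← h5, h2, homogeneousComponent_eq_self D.bb_homog]
  · rw [h3]
    exact Log.sum fun j _ => (hM j).1.smul _

theorem phi_gen (D : Res s R a r α π) {φ : Fin ℓ → MvPolynomial (Fin ℓ) k} (hφ : Log s a φ)
    (h : π (app α φ) = ∏ i ∈ s \ R, π (lin (a i))) {η} (hη : Log s a η) :
    ∃ g : MvPolynomial (Fin ℓ) k, Log s a (η - g • φ) ∧ lin α ∣ app α (η - g • φ) := by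
  obtain ⟨g, hg⟩ := D.bb_dvd hη
  have hb := D.pne' (t := s \ R) Finset.sdiff_subset
  have hpg : π g = g := by
    have := congrArg π hg
    rw [D.P.idem, map_mul, map_prod, hg] at this
    simp only [D.P.idem] at this
    exact (mul_left_cancel₀ hb this).symm
  refine ⟨g, hη.sub (hφ.smul _), ?_⟩
  rw [D.P.dvd_iff, app_sub, app_smul, map_sub, map_mul, h, hpg, hg]; ring

theorem phi_syz (D : Res s R a r α π)
    (M : Fin ℓ → Fin ℓ → MvPolynomial (Fin ℓ) k)
    (hM : ∀ j, Log s a (M j) ∧ lin α ∣ app α (M j))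
    (hind : ∀ f : Fin ℓ → MvPolynomial (Fin ℓ) k, ∑ j, f j • M j = 0 → ∀ j, f j = 0)
    (φ : Fin ℓ → MvPolynomial (Fin ℓ) k) (c : Fin ℓ → MvPolynomial (Fin ℓ) k)
    (h1 : lin α • φ = ∑ j, c j • M j) (h2 : π (app α φ) = ∏ i ∈ s \ R, π (lin (a i)))
    (g : Fin ℓ → MvPolynomial (Fin ℓ) k) (h : MvPolynomial (Fin ℓ) k)
    (hg : (∑ j, g j • M j) + h • φ = 0) :
    ∃ q : MvPolynomial (Fin ℓ) k, (∀ i, g i = q * (- c i)) ∧ h = q * lin α := by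
  have hα0 := lin_ne_zero D.P.ne
  have h3 : ∀ j, lin α * g j + h * c j = 0 := hind _ (by
    simp only [add_smul, mul_smul, Finset.sum_add_distrib, ← Finset.smul_sum]
    rw [← h1, smul_comm h, ← smul_add, hg, smul_zero])
  obtain ⟨j, hj⟩ : ∃ j, ¬ lin α ∣ c j := by
    by_contra! hall
    choose w hw using hall
    have h4 : φ = ∑ j, w j • M j := by
      have : lin α • φ = lin α • ∑ j, w j • M j := by
        rw [h1, Finset.smul_sum]
        exact Finset.sum_congr rfl fun j _ => by rw [smul_smul, ← hw]
      funext i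
      exact mul_left_cancel₀ hα0 (congrFun this i)
    have h5 : π (app α φ) = 0 := by
      rw [h4, app_sum, map_sum]
      exact Finset.sum_eq_zero fun j _ => by
        rw [app_smul, map_mul, (D.P.dvd_iff _).1 (hM j).2, mul_zero]
    exact D.pne' (t := s \ R) Finset.sdiff_subset (h2.symm.trans h5)
  obtain ⟨q, hq⟩ : lin α ∣ h :=
    ((lin_prime D.P.ne).dvd_or_dvd (a := h) (b := c j) ⟨- g j, by linear_combination h3 j⟩).resolve_right hj
  refine ⟨q, fun i => mul_left_cancel₀ hα0 ?_, by rw [hq, mul_comm]⟩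
  linear_combination h3 i - c i * hq

/-- the level -/
theorem level (D : Res s R a r α π) {φ₀ φ : Fin ℓ → MvPolynomial (Fin ℓ) k}
    (h0 : π (app α φ₀) = ∏ i ∈ s \ R, π (lin (a i))) (hφ : Log s a φ) {lev : ℕ}
    (hh : ∀ i, (φ i).IsHomogeneous lev) (θ : Fin ℓ → Fin ℓ → MvPolynomial (Fin ℓ) k)
    (hθ : ∀ j, lin α ∣ app α (θ j)) (c : Fin ℓ → MvPolynomial (Fin ℓ) k) (g : MvPolynomial (Fin ℓ) k)
    (he : φ₀ = (∑ i, c i • θ i) + g • φ) : lev = (s \ R).card := by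
  have hb := D.pne' (t := s \ R) Finset.sdiff_subset
  have h1 : ∏ i ∈ s \ R, π (lin (a i)) = π (app α φ) * π g := by
    rw [← h0, he, app_add, app_sum, app_smul, map_add, map_sum, map_mul, mul_comm]
    rw [Finset.sum_eq_zero, zero_add]
    intro j _
    rw [app_smul, map_mul, (D.P.dvd_iff _).1 (hθ j), mul_zero]
  have hne : π (app α φ) ≠ 0 := by
    intro h; rw [h, zero_mul] at h1; exact hb h1
  have h2 := totalDegree_le_of_dvd_of_isDomain ⟨_, h1⟩ hb
  have h3 := totalDegree_le_of_dvd_of_isDomain (D.bb_dvd hφ) hne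
  rw [D.bb_homog.totalDegree hb, (D.P.hom _ _ (app_homog α hh)).totalDegree hne] at h2 h3
  omega
end Res
end ArrAux

end

noncomputable section

attribute [local instance] Classical.propDecidable

namespace ArrPOG
variable {K : Type} [Field K] {ℓ : ℕ}

/-- signed count of subsets with given intersection -/
def sgn (A : Finset (Submodule K (Fin ℓ → K))) (X : Submodule K (Fin ℓ → K)) : ℤ :=
  ∑ B ∈ A.powerset.filter (fun B => B.inf id = X), (-1) ^ B.card

theorem mem_lat (A : Finset (Submodule K (Fin ℓ → K))) (X) :
    X ∈ latticeOf ⊤ A ↔ ∃ B ⊆ A, B.inf id = X := by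
  simp [latticeOf]

theorem ne_top {A : Finset (Submodule K (Fin ℓ → K))} (hA : IsArrangement A) {L} (hL : L ∈ A) :
    L ≠ ⊤ := by
  obtain ⟨φ, h, rfl⟩ := hA L hL
  rwa [Ne, LinearMap.ker_eq_top]

theorem sgn_top {A : Finset (Submodule K (Fin ℓ → K))} (hA : IsArrangement A) : sgn A ⊤ = 1 := by
  unfold sgn
  have : A.powerset.filter (fun B => B.inf id = ⊤) = {∅} := by
    ext B
    simp only [Finset.mem_filter, Finset.mem_powerset, Finset.mem_singleton]
    constructor
    · rintro ⟨h1, h2⟩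
      by_contra hne
      obtain ⟨L, hL⟩ := Finset.nonempty_iff_ne_empty.2 hne
      have : B.inf id ≤ L := Finset.inf_le (f := id) hL
      rw [h2, top_le_iff] at this
      exact ne_top hA (h1 hL) this
    · rintro rfl; simp
  rw [this]; simp

theorem sgn_rec (A : Finset (Submodule K (Fin ℓ → K))) {X}
    (hX : X ∈ latticeOf ⊤ A) (hT : X ≠ ⊤) :
    sgn A X = - ∑ Y ∈ (latticeOf ⊤ A).filter (fun Z => X < Z), sgn A Y := by
  obtain ⟨B0, hB0, hBX⟩ := (mem_lat A X).1 hX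
  have hne : (A.filter (fun L => X ≤ L)).Nonempty := by
    have : B0.Nonempty := by
      rw [Finset.nonempty_iff_ne_empty]; rintro rfl; exact hT (by rw [← hBX]; simp)
    obtain ⟨L, hL⟩ := this
    exact ⟨L, Finset.mem_filter.2 ⟨hB0 hL, hBX ▸ Finset.inf_le (f := id) hL⟩⟩
  have h0 := Finset.sum_powerset_neg_one_pow_card_of_nonempty hne
  rw [← Finset.sum_fiberwise_of_maps_to (t := (latticeOf ⊤ A).filter (fun Z => X ≤ Z))
    (g := fun B => B.inf id)] at h0
  · have h1 : ∀ Y ∈ (latticeOf ⊤ A).filter (fun Z => X ≤ Z),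
        ∑ B ∈ (A.filter (fun L => X ≤ L)).powerset.filter (fun B => B.inf id = Y), (-1 : ℤ) ^ B.card
          = sgn A Y := by
      intro Y hY
      rw [Finset.mem_filter] at hY
      unfold sgn
      refine Finset.sum_congr ?_ fun _ _ => rfl
      ext B
      simp only [Finset.mem_filter, Finset.mem_powerset]
      constructor
      · rintro ⟨h1, h2⟩; exact ⟨h1.trans (Finset.filter_subset _ _), h2⟩
      · rintro ⟨h1, h2⟩
        refine ⟨fun L hL => Finset.mem_filter.2 ⟨h1 hL, ?_⟩, h2⟩
        exact (hY.2.trans h2.ge).trans (Finset.inf_le (f := id) hL)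
    rw [Finset.sum_congr rfl h1] at h0
    have h2 : (latticeOf ⊤ A).filter (fun Z => X ≤ Z) =
        insert X ((latticeOf ⊤ A).filter (fun Z => X < Z)) := by
      ext Z
      simp only [Finset.mem_filter, Finset.mem_insert]
      constructor
      · rintro ⟨h1, h2⟩
        rcases h2.eq_or_lt with h | h
        · exact Or.inl h.symm
        · exact Or.inr ⟨h1, h⟩
      · rintro (rfl | ⟨h1, h2⟩)
        · exact ⟨hX, le_rfl⟩
        · exact ⟨h1, h2.le⟩
    rw [h2, Finset.sum_insert (by simp)] at h0
    linarith
  · intro B hB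
    rw [Finset.mem_powerset] at hB
    refine Finset.mem_filter.2 ⟨(mem_lat _ _).2 ⟨B, hB.trans (Finset.filter_subset _ _), rfl⟩, ?_⟩
    exact Finset.le_inf fun L hL => (Finset.mem_filter.1 (hB hL)).2

theorem mob_eq {A : Finset (Submodule K (Fin ℓ → K))} (hA : IsArrangement A) :
    ∀ (n : ℕ) (X) , ((latticeOf ⊤ A).filter fun Z => X < Z).card = n → X ∈ latticeOf ⊤ A →
      mob ⊤ (latticeOf ⊤ A) X = sgn A X := by
  intro n
  induction n using Nat.strong_induction_on with
  | _ n ih =>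
    intro X hn hX
    by_cases hT : X = ⊤
    · subst hT; rw [mob, if_pos rfl, sgn_top hA]
    · rw [mob, if_neg hT, sgn_rec A hX hT,
        Finset.sum_attach ((latticeOf ⊤ A).filter fun Z => X < Z) (fun Y => mob ⊤ (latticeOf ⊤ A) Y)]
      congr 1
      refine Finset.sum_congr rfl fun Y hY => ?_
      rw [Finset.mem_filter] at hY
      refine ih _ ?_ Y rfl hY.1
      rw [← hn]
      apply Finset.card_lt_card
      rw [Finset.ssubset_iff_of_subset]
      · exact ⟨Y, Finset.mem_filter.2 hY, by simp⟩
      · intro Z hZ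
        rw [Finset.mem_filter] at hZ ⊢
        exact ⟨hZ.1, hY.2.trans hZ.2⟩

theorem whitney {A : Finset (Submodule K (Fin ℓ → K))} (hA : IsArrangement A) :
    charPoly ⊤ A = ∑ B ∈ A.powerset, Polynomial.C ((-1 : ℤ) ^ B.card) *
      Polynomial.X ^ (Module.finrank K (B.inf id : Submodule K (Fin ℓ → K))) := by
  unfold charPoly
  rw [← Finset.sum_fiberwise_of_maps_to (s := A.powerset) (t := latticeOf ⊤ A)
    (g := fun B => B.inf id) (fun B hB => (mem_lat _ _).2 ⟨B, Finset.mem_powerset.1 hB, rfl⟩)]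
  refine Finset.sum_congr rfl fun X hX => ?_
  rw [mob_eq hA _ X rfl hX, sgn, map_sum, Finset.sum_mul]
  refine Finset.sum_congr rfl fun B hB => ?_
  rw [(Finset.mem_filter.1 hB).2]

theorem finrank_hyp {φ : Module.Dual K (Fin ℓ → K)} (h : φ ≠ 0) :
    Module.finrank K (LinearMap.ker φ) + 1 = ℓ := by
  have h1 := LinearMap.finrank_range_add_finrank_ker φ
  rw [LinearMap.range_eq_top.2 (LinearMap.surjective h), finrank_top] at h1
  simp at h1
  omega

theorem sum_exp {A : Finset (Submodule K (Fin ℓ → K))} (hA : IsArrangement A) (hℓ : 0 < ℓ)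
    (e : Fin ℓ → ℕ)
    (hchi : charPoly ⊤ A = ∏ i, (Polynomial.X - Polynomial.C ((e i : ℤ)))) :
    ∑ i, e i = A.card := by
  have h1 := congrArg (fun p => Polynomial.coeff p (ℓ - 1)) hchi
  have h2 := Polynomial.prod_X_sub_C_coeff_card_pred (Finset.univ : Finset (Fin ℓ))
    (fun i => (e i : ℤ)) (by simpa using hℓ)
  simp only [Finset.card_univ, Fintype.card_fin] at h2
  simp only [h2, whitney hA, Polynomial.finsetSum_coeff, Polynomial.coeff_C_mul_X_pow] at h1
  rw [← Finset.sum_filter] at h1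
  have h3 : A.powerset.filter (fun B => ℓ - 1 =
      Module.finrank K (B.inf id : Submodule K (Fin ℓ → K))) =
      A.map ⟨fun L => {L}, Finset.singleton_injective⟩ := by
    ext B
    simp only [Finset.mem_filter, Finset.mem_powerset, Finset.mem_map, Function.Embedding.coeFn_mk]
    constructor
    · rintro ⟨hB, hr⟩
      have hall : ∀ L ∈ B, B.inf id = L := by
        intro L hL
        refine Submodule.eq_of_le_of_finrank_eq (Finset.inf_le (f := id) hL) ?_
        obtain ⟨φ, hφ, rfl⟩ := hA L (hB hL)
        have := finrank_hyp hφ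
        omega
      have hne : B.Nonempty := by
        rw [Finset.nonempty_iff_ne_empty]
        rintro rfl
        rw [Finset.inf_empty, finrank_top] at hr
        simp at hr
        omega
      obtain ⟨L, hL⟩ := hne
      refine ⟨L, hB hL, ?_⟩
      ext L'
      rw [Finset.mem_singleton]
      constructor
      · rintro rfl; exact hL
      · intro h; rw [← hall L' h, hall L hL]
    · rintro ⟨L, hL, rfl⟩
      refine ⟨by simpa using hL, ?_⟩
      obtain ⟨φ, hφ, rfl⟩ := hA L hL
      have := finrank_hyp hφ
      rw [Finset.inf_singleton]
      change ℓ - 1 = Module.finrank K (LinearMap.ker φ)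
      omega
  rw [h3, Finset.sum_map] at h1
  simp at h1
  exact_mod_cast h1.symm

theorem exp_unique {e e' : Fin ℓ → ℕ}
    (h : ∏ i, (Polynomial.X - Polynomial.C ((e i : ℤ))) =
      ∏ i, (Polynomial.X - Polynomial.C ((e' i : ℤ)))) : expMS e = expMS e' := by
  have h1 := congrArg Polynomial.roots h
  have key : ∀ f : Fin ℓ → ℕ, (∏ i, (Polynomial.X - Polynomial.C ((f i : ℤ)))).roots =
      (expMS f).map (Nat.cast : ℕ → ℤ) := by
    intro f
    have := Polynomial.roots_multiset_prod_X_sub_C ((expMS f).map (Nat.cast : ℕ → ℤ))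
    rw [← this]
    congr 1
    simp only [expMS, Finset.prod, Multiset.map_map]
    rfl
  rw [key, key] at h1
  exact Multiset.map_injective Nat.cast_injective h1

end ArrPOG
namespace ArrPOG
variable {K : Type} [Field K] {ℓ : ℕ}

open ArrAux

theorem exists_perm {e e' : Fin ℓ → ℕ} (h : expMS e = expMS e') :
    ∃ σ : Equiv.Perm (Fin ℓ), ∀ i, e' (σ i) = e i := by
  have h1 : ∀ n, Nonempty ({i // e i = n} ≃ {i // e' i = n}) := by
    intro n
    rw [← Fintype.card_eq]
    have := congrArg (Multiset.count n) h
    simp only [expMS, Multiset.count_map] at this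
    rw [Fintype.card_subtype, Fintype.card_subtype]
    simp only [Finset.card, Finset.filter_val]
    simp only [@eq_comm _ n] at this
    convert this
  have F := fun n => (h1 n).some
  refine ⟨((Equiv.sigmaFiberEquiv e).symm.trans (Equiv.sigmaCongrRight F)).trans
    (Equiv.sigmaFiberEquiv e'), fun i => ?_⟩
  simp only [Equiv.trans_apply]
  exact (F (e i) ⟨i, rfl⟩).2

/-- coefficient vector -/
def vec (φ : Module.Dual K (Fin ℓ → K)) : Fin ℓ → K := fun i => φ (Pi.single i 1)

theorem vec_apply (φ : Module.Dual K (Fin ℓ → K)) (x : Fin ℓ → K) :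
    φ x = ∑ i, vec φ i * x i := by
  have h : x = ∑ i, x i • (Pi.single i 1 : Fin ℓ → K) := by
    funext j
    simp [Finset.sum_apply, Pi.single_apply]
  conv_lhs => rw [h]
  rw [map_sum]
  exact Finset.sum_congr rfl fun i _ => by rw [map_smul, smul_eq_mul, mul_comm]; rfl

theorem vec_inj {φ ψ : Module.Dual K (Fin ℓ → K)} (h : vec φ = vec ψ) : φ = ψ := by
  refine LinearMap.ext fun x => ?_
  rw [vec_apply, vec_apply, h]

theorem vec_smul (c : K) (φ : Module.Dual K (Fin ℓ → K)) : vec (c • φ) = c • vec φ := rfl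
theorem vec_add (φ ψ : Module.Dual K (Fin ℓ → K)) : vec (φ + ψ) = vec φ + vec ψ := rfl

theorem dual_prop {φ ψ : Module.Dual K (Fin ℓ → K)} (hψ : ψ ≠ 0)
    (h : LinearMap.ker φ = LinearMap.ker ψ) : ∃ c : K, φ = c • ψ := by
  obtain ⟨x, hx⟩ : ∃ x, ψ x ≠ 0 := by
    by_contra! h'; exact hψ (LinearMap.ext h')
  refine ⟨φ x / ψ x, LinearMap.ext fun y => ?_⟩
  have h1 : y - (ψ y / ψ x) • x ∈ LinearMap.ker ψ := by
    rw [LinearMap.mem_ker, map_sub, map_smul, smul_eq_mul, div_mul_cancel₀ _ hx, sub_self]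
  rw [← h, LinearMap.mem_ker, map_sub, map_smul, smul_eq_mul, sub_eq_zero] at h1
  rw [h1, LinearMap.smul_apply, smul_eq_mul]; ring

theorem dual_span {φ ψ χ : Module.Dual K (Fin ℓ → K)}
    (h : LinearMap.ker ψ ⊓ LinearMap.ker χ ≤ LinearMap.ker φ) : ∃ c c' : K, φ = c • ψ + c' • χ := by
  have := FiniteDimensional.mem_span_of_iInf_ker_le_ker (L := fun b : Bool => if b then ψ else χ)
    (K := φ) (by
      intro x hx
      rw [Submodule.mem_iInf] at hx
      exact h ⟨by simpa using hx true, by simpa using hx false⟩)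
  have hr : Set.range (fun b : Bool => if b then ψ else χ) = {ψ, χ} := by
    ext x; simp [or_comm, eq_comm]
  rw [hr, Submodule.mem_span_pair] at this
  obtain ⟨c, c', h⟩ := this
  exact ⟨c, c', h.symm⟩

/-- data of chosen forms -/
structure Forms (A : Finset (Submodule K (Fin ℓ → K)))
    (F : Submodule K (Fin ℓ → K) → Module.Dual K (Fin ℓ → K)) : Prop where
  ne : ∀ L ∈ A, F L ≠ 0
  ker : ∀ L ∈ A, LinearMap.ker (F L) = L

theorem exists_forms {A : Finset (Submodule K (Fin ℓ → K))} (hA : IsArrangement A) :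
    ∃ F, Forms A F := by
  have : ∀ L, ∃ φ : Module.Dual K (Fin ℓ → K), L ∈ A → φ ≠ 0 ∧ LinearMap.ker φ = L := by
    intro L
    by_cases h : L ∈ A
    · obtain ⟨φ, h⟩ := hA L h; exact ⟨φ, fun _ => h⟩
    · exact ⟨0, fun h' => absurd h' h⟩
  choose F hF using this
  exact ⟨F, fun L h => (hF L h).1, fun L h => (hF L h).2⟩

namespace Forms
variable {A : Finset (Submodule K (Fin ℓ → K))}
  {F : Submodule K (Fin ℓ → K) → Module.Dual K (Fin ℓ → K)}

theorem sub (D : Forms A F) {B} (h : B ⊆ A) : Forms B F :=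
  ⟨fun L hL => D.ne L (h hL), fun L hL => D.ker L (h hL)⟩

theorem vne (D : Forms A F) {L} (hL : L ∈ A) : vec (F L) ≠ 0 := by
  intro h; exact D.ne L hL (vec_inj (h.trans (by funext i; rfl)))

theorem np (D : Forms A F) : NonProp A (fun L => vec (F L)) := by
  refine ⟨fun L hL => D.vne hL, fun L hL L' hL' hne c hc => hne ?_⟩
  have hc' : F L' = c • F L := vec_inj hc
  have hc0 : c ≠ 0 := by rintro rfl; exact D.ne L' hL' (by rw [hc', zero_smul])
  rw [← D.ker L hL, ← D.ker L' hL', hc', LinearMap.ker_smul _ _ hc0]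

theorem inD_iff (D : Forms A F) (θ : Deriv K ℓ) : InD A θ ↔ Log A (fun L => vec (F L)) θ := by
  constructor
  · intro h L hL
    exact h L hL (F L) (D.ker L hL)
  · intro h L hL φ hφ
    obtain ⟨c, rfl⟩ := dual_prop (D.ne L hL) (hφ.trans (D.ker L hL).symm)
    change lin (vec (c • F L)) ∣ app (vec (c • F L)) θ
    rw [vec_smul, lin_smul, app_smul']
    exact mul_dvd_mul_left _ (h L hL)

theorem log_split (D : Forms A F) {H} (hH : H ∈ A) (θ : Deriv K ℓ) :
    InD A θ ↔ Log (A.erase H) (fun L => vec (F L)) θ ∧ lin (vec (F H)) ∣ app (vec (F H)) θ := by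
  rw [D.inD_iff]
  constructor
  · intro h; exact ⟨fun L hL => h L (Finset.mem_of_mem_erase hL), h H hH⟩
  · rintro ⟨h1, h2⟩ L hL
    by_cases h : L = H
    · subst h; exact h2
    · exact h1 L (Finset.mem_erase.2 ⟨h, hL⟩)

theorem res (D : Forms A F) {H} (hH : H ∈ A) {d : ℕ}
    (hd : (d : ℤ) = ((A.erase H).card : ℤ) - ((restrict A H).card : ℤ)) :
    ∃ R r π, Res (A.erase H) R (fun L => vec (F L)) r (vec (F H)) π ∧
      ((A.erase H) \ R).card = d ∧ ((A.erase H).Nonempty → R.Nonempty) := by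
  obtain ⟨π, hπ⟩ := exists_proj (D.vne hH)
  have h1 : ∀ X, ∃ L, X ∈ restrict A H → L ∈ A.erase H ∧ L ⊓ H = X := by
    intro X
    by_cases h : X ∈ restrict A H
    · obtain ⟨L, hL⟩ := Finset.mem_image.1 h
      exact ⟨L, fun _ => hL⟩
    · exact ⟨⊥, fun h' => absurd h' h⟩
  choose rep hrep using h1
  have hmem : ∀ L ∈ A.erase H, L ⊓ H ∈ restrict A H := fun L hL =>
    Finset.mem_image.2 ⟨L, hL, rfl⟩
  have hRS : (restrict A H).image rep ⊆ A.erase H := by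
    intro L hL
    obtain ⟨X, hX, rfl⟩ := Finset.mem_image.1 hL
    exact (hrep X hX).1
  have hcard : ((restrict A H).image rep).card = (restrict A H).card := by
    apply Finset.card_image_of_injOn
    intro X hX Y hY hXY
    rw [← (hrep X hX).2, ← (hrep Y hY).2]
    exact congrArg (· ⊓ H) hXY
  have hnp : ∀ L ∈ A.erase H, ∀ c : K, vec (F L) ≠ c • vec (F H) := fun L hL c =>
    D.np.2 H hH L (Finset.mem_of_mem_erase hL) (Finset.ne_of_mem_erase hL).symm c
  refine ⟨(restrict A H).image rep, fun L => rep (L ⊓ H), π, ?_, ?_, ?_⟩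
  · refine ⟨hπ, (D.sub (Finset.erase_subset _ _)).np, hnp, hRS, ?_, ?_, ?_, ?_⟩
    · intro L hL
      exact Finset.mem_image_of_mem _ (hmem L hL)
    · intro L hL
      obtain ⟨X, hX, rfl⟩ := Finset.mem_image.1 hL
      rw [(hrep X hX).2]
    · intro L hL
      have h2 := hrep _ (hmem L hL)
      obtain ⟨c, c', hc⟩ := dual_span (φ := F L) (ψ := F (rep (L ⊓ H))) (χ := F H) (by
        rw [D.ker H hH, D.ker _ (Finset.mem_of_mem_erase h2.1), h2.2,
          D.ker L (Finset.mem_of_mem_erase hL)]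
        exact inf_le_left)
      refine ⟨c, c', ?_, by simp only [hc, vec_add, vec_smul]⟩
      rintro rfl
      exact hnp L hL c' (by rw [hc, zero_smul, zero_add, vec_smul])
    · intro L hL L' hL' hne c c' h
      have h' : F L' = c • F L + c' • F H := vec_inj h
      have hLs := Finset.mem_of_mem_erase (hRS hL)
      have hLs' := Finset.mem_of_mem_erase (hRS hL')
      have hc : c ≠ 0 := by
        rintro rfl
        exact hnp L' (hRS hL') c' (by rw [h', zero_smul, zero_add, vec_smul])
      have heq : L ⊓ H = L' ⊓ H := by
        have key : ∀ x, x ∈ H → (x ∈ L ↔ x ∈ L') := by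
          intro x hx
          rw [← D.ker L hLs, ← D.ker L' hLs', LinearMap.mem_ker, LinearMap.mem_ker, h']
          rw [← D.ker H hH, LinearMap.mem_ker] at hx
          simp [hx, hc]
        ext x
        simp only [Submodule.mem_inf]
        constructor
        · rintro ⟨h1, h2⟩; exact ⟨(key x h2).1 h1, h2⟩
        · rintro ⟨h1, h2⟩; exact ⟨(key x h2).2 h1, h2⟩
      obtain ⟨X, hX, rfl⟩ := Finset.mem_image.1 hL
      obtain ⟨Y, hY, rfl⟩ := Finset.mem_image.1 hL'
      rw [(hrep X hX).2, (hrep Y hY).2] at heq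
      exact hne (by rw [heq])
  · rw [Finset.card_sdiff_of_subset hRS, hcard]
    have : (restrict A H).card ≤ (A.erase H).card := Finset.card_image_le
    omega
  · rintro ⟨L, hL⟩
    exact ⟨_, Finset.mem_image_of_mem rep (hmem L hL)⟩

end Forms
end ArrPOG
namespace ArrPOG
variable {K : Type} [Field K] {ℓ : ℕ}

open ArrAux

theorem inf_eq_ker {A : Finset (Submodule K (Fin ℓ → K))}
    {F : Submodule K (Fin ℓ → K) → Module.Dual K (Fin ℓ → K)} (D : Forms A F) (B : Finset A) :
    LinearMap.ker (Matrix.of fun (i : B) t => vec (F i.1.1) t).mulVecLin =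
      (B.map (Function.Embedding.subtype (· ∈ A))).inf id := by
  ext x
  rw [LinearMap.mem_ker, Finset.inf_map, Submodule.mem_finsetInf]
  constructor
  · intro h i hi
    have := congrFun h ⟨i, hi⟩
    change x ∈ i.1
    rw [← D.ker i.1 i.2, LinearMap.mem_ker, vec_apply]
    exact this
  · intro h
    funext i
    have := h i.1 i.2
    change x ∈ i.1.1 at this
    rw [← D.ker i.1.1 i.1.2, LinearMap.mem_ker, vec_apply] at this
    exact this

theorem charPoly_free {A : Finset (Submodule K (Fin ℓ → K))} (hA : IsArrangement A)
    {eA : Fin ℓ → ℕ} (hF : IsFreeExp A eA) :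
    charPoly ⊤ A = ∏ i, (Polynomial.X - Polynomial.C ((eA i : ℤ))) := by
  obtain ⟨F, D⟩ := exists_forms hA
  obtain ⟨θ, hh, ⟨hD, hgen⟩, hind⟩ := hF
  simp only [D.inD_iff] at hD hgen
  obtain ⟨c, hc, hdet⟩ := saito_fwd D.np (M := θ) hD hgen hind
  have hdeg := saito_degree D.np (M := θ) eA hh hc hdet
  have hnp : NonProp (Finset.univ : Finset A) (fun i => vec (F i.1)) :=
    ⟨fun i _ => D.np.1 i.1 i.2, fun i _ j _ hij c => D.np.2 i.1 i.2 j.1 j.2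
      (fun h => hij (Subtype.ext h)) c⟩
  have hQ : Qp (Finset.univ : Finset A) (fun i => vec (F i.1)) = Qp A (fun L => vec (F L)) :=
    Finset.prod_coe_sort A (fun L => lin (vec (F L)))
  have h1 := terao (d := eA) hnp θ (fun j i _ => hD j i.1 i.2) hc (by rw [hQ]; exact hdet)
    (fun j i => (hh j i).totalDegree_le) (by rw [hdeg]; simp)
  rw [← h1, whitney hA]
  symm
  refine Finset.sum_bij (fun B _ => B.map (Function.Embedding.subtype (· ∈ A))) ?_ ?_ ?_ ?_
  · intro B _
    rw [Finset.mem_powerset]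
    intro L hL
    obtain ⟨i, _, rfl⟩ := Finset.mem_map.1 hL
    exact i.2
  · intro B _ B' _ h
    exact Finset.map_injective _ h
  · intro B hB
    refine ⟨B.subtype (· ∈ A), Finset.mem_univ _, ?_⟩
    exact Finset.subtype_map_of_mem fun x hx => Finset.mem_powerset.1 hB hx
  · intro B _
    rw [inf_eq_ker D, Finset.card_map]

theorem free_exp {A : Finset (Submodule K (Fin ℓ → K))} (hA : IsArrangement A) {e : Fin ℓ → ℕ}
    (hchi : charPoly ⊤ A = ∏ i, (Polynomial.X - Polynomial.C ((e i : ℤ))))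
    {eA : Fin ℓ → ℕ} (hF : IsFreeExp A eA) : expMS eA = expMS e :=
  exp_unique ((charPoly_free hA hF).symm.trans hchi)

theorem free_perm {A : Finset (Submodule K (Fin ℓ → K))} {e eA : Fin ℓ → ℕ}
    (hF : IsFreeExp A eA) (h : expMS eA = expMS e) : IsFreeExp A e := by
  obtain ⟨σ, hσ⟩ := exists_perm h.symm
  obtain ⟨θ, hh, ⟨hD, hgen⟩, hind⟩ := hF
  refine ⟨fun i => θ (σ i), fun i => ?_, ⟨fun i => hD _, fun η hη => ?_⟩, fun c hc i => ?_⟩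
  · rw [← hσ i]; exact hh _
  · obtain ⟨c, hc⟩ := hgen η hη
    refine ⟨fun i => c (σ i), ?_⟩
    rw [hc]
    exact (Equiv.sum_comp σ (fun i => c i • θ i)).symm
  · have := hind (fun i => c (σ.symm i)) (by
      rw [← Equiv.sum_comp σ]; simpa using hc) (σ i)
    simpa using this

/-- homogeneous basis of `D(A)` yields the extra derivation -/
theorem free_phi {A : Finset (Submodule K (Fin ℓ → K))}
    {F : Submodule K (Fin ℓ → K) → Module.Dual K (Fin ℓ → K)} (D : Forms A F)
    {H : Submodule K (Fin ℓ → K)} (hH : H ∈ A) {e : Fin ℓ → ℕ} {R r π}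
    (S : Res (A.erase H) R (fun L => vec (F L)) r (vec (F H)) π) (hR : R.Nonempty)
    (hbig : ∀ i, e i < ((A.erase H) \ R).card)
    (hF : IsFreeExp A e) :
    IsSPOG (A.erase H) e ((A.erase H) \ R).card ∧
      ∃ φ₀, InD (A.erase H) φ₀ ∧
        π (app (vec (F H)) φ₀) = ∏ i ∈ (A.erase H) \ R, π (lin (vec (F i))) := by
  have D' := D.sub (Finset.erase_subset H A)
  obtain ⟨θ, hh, ⟨hD, hgen⟩, hind⟩ := hF
  simp only [D.log_split hH] at hD hgen
  have hgen' : ∀ η, Log (A.erase H) (fun L => vec (F L)) η → lin (vec (F H)) ∣ app (vec (F H)) η →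
      ∃ f : Fin ℓ → MvPolynomial (Fin ℓ) K, η = ∑ j, f j • θ j := fun η h1 h2 => hgen η ⟨h1, h2⟩
  obtain ⟨φ, c, h1, h2, h3, h4, h5⟩ := S.exists_phi_homog hR θ e hh hbig hD hgen' hind
  refine ⟨⟨θ, φ, fun i => - c i, lin (vec (F H)), ⟨fun i => (D'.inD_iff _).2 (hD i).1,
    (D'.inD_iff _).2 h5, hh, h3, ?_, lin_homog _, fun i => (h4 i).neg, ?_, ?_, ?_, ?_⟩,
    lin_ne_zero S.P.ne⟩, φ, (D'.inD_iff _).2 h5, h2⟩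
  · intro η hη
    obtain ⟨g, hg1, hg2⟩ := S.phi_gen h5 h2 ((D'.inD_iff _).1 hη)
    obtain ⟨f, hf⟩ := hgen' _ hg1 hg2
    exact ⟨f, g, by rw [← hf]; simp⟩
  · intro i
    rw [map_neg, neg_eq_zero, constantCoeff_eq]
    by_contra h0
    have := h4 i h0
    have := hbig i
    simp at *
    omega
  · simp only [neg_smul, Finset.sum_neg_distrib]
    rw [h1]; simp
  · intro h
    exact lin_ne_zero S.P.ne h.1
  · intro g h hg
    exact S.phi_syz θ hD hind φ c h1 h2 g h hg

theorem spog_log {A : Finset (Submodule K (Fin ℓ → K))}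
    {F : Submodule K (Fin ℓ → K) → Module.Dual K (Fin ℓ → K)} (D : Forms A F)
    {H : Submodule K (Fin ℓ → K)} (hH : H ∈ A) {e : Fin ℓ → ℕ} {R r π}
    (S : Res (A.erase H) R (fun L => vec (F L)) r (vec (F H)) π)
    (hbig : ∀ i, e i < ((A.erase H) \ R).card) {θ : Fin ℓ → Deriv K ℓ}
    (h1 : ∀ i, InD (A.erase H) (θ i)) (h2 : ∀ i, HomogDeriv (θ i) (e i)) (i) : InD A (θ i) := by
  have D' := D.sub (Finset.erase_subset H A)
  have h3 := (D'.inD_iff _).1 (h1 i)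
  exact (D.log_split hH _).2 ⟨h3, S.low_deg h3 (h2 i) (hbig i)⟩

theorem spog_free {A : Finset (Submodule K (Fin ℓ → K))}
    {F : Submodule K (Fin ℓ → K) → Module.Dual K (Fin ℓ → K)} (D : Forms A F)
    {H : Submodule K (Fin ℓ → K)} (hH : H ∈ A) {e : Fin ℓ → ℕ} {R r π}
    (S : Res (A.erase H) R (fun L => vec (F L)) r (vec (F H)) π)
    (hbig : ∀ i, e i < ((A.erase H) \ R).card) (hsum : ∑ i, e i = A.card) {lev : ℕ}
    (hS : IsSPOG (A.erase H) e lev) : IsFreeExp A e := by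
  obtain ⟨θ, φ, f, α, ⟨h1, h2, h3, h4, h5, h6, h7, h8, h9, h10, h11⟩, hα⟩ := hS
  have hD := spog_log D hH S hbig h1 h3
  have hind : IndepD θ := by
    intro c hc i
    obtain ⟨q, hq, hq'⟩ := h11 c 0 (by rw [hc, zero_smul, add_zero])
    have : q = 0 := (mul_eq_zero.1 hq'.symm).resolve_right hα
    rw [hq i, this, zero_mul]
  have hlog := fun i => (D.inD_iff _).1 (hD i)
  obtain ⟨c, hc, hdet⟩ := saito_of_degree D.np (M := θ) e h3 hlog
    (det_ne_zero_of_indep _ hind) hsum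
  refine ⟨θ, h3, ⟨hD, fun η hη => ?_⟩, hind⟩
  obtain ⟨g, hg, _⟩ := saito_gen D.np (M := θ) hlog hc hdet η ((D.inD_iff _).1 hη)
  exact ⟨g, hg⟩

theorem relative_criterion_large_level {K : Type} [Field K] {ℓ : ℕ}
    (A : Finset (Submodule K (Fin ℓ → K)))
    (hA : IsArrangement A) (hEss : Essential A)
    (H : Submodule K (Fin ℓ → K)) (hH : H ∈ A)
    (e : Fin ℓ → ℕ)
    (hchi : charPoly ⊤ A = ∏ i, (Polynomial.X - Polynomial.C ((e i : ℤ))))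
    (d : ℕ) (hd : (d : ℤ) = ((A.erase H).card : ℤ) - ((restrict A H).card : ℤ))
    (hbig : ∀ i, e i < d) :
    (IsFree A ↔ ∃ lev, IsSPOG (A.erase H) e lev) ∧
    (IsFree A →
      (∀ eA : Fin ℓ → ℕ, IsFreeExp A eA → expMS eA = expMS e) ∧
      (∀ lev, IsSPOG (A.erase H) e lev → lev = d)) := by
  obtain ⟨F, D⟩ := exists_forms hA
  have hℓ : 0 < ℓ := by
    have := finrank_hyp (D.ne H hH)
    omega
  obtain ⟨R, r, π, S, hcard, hne⟩ := D.res hH hd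
  subst hcard
  have hA' : (A.erase H).Nonempty := by
    rw [← Finset.card_pos]
    have := hbig ⟨0, hℓ⟩
    have : ((A.erase H) \ R).card ≤ (A.erase H).card := Finset.card_le_card Finset.sdiff_subset
    omega
  have hR := hne hA'
  have hsum := sum_exp hA hℓ e hchi
  have hfree : IsFree A → IsFreeExp A e := fun ⟨eA, h⟩ => free_perm h (free_exp hA hchi h)
  refine ⟨⟨fun h => ⟨_, (free_phi D hH S hR hbig (hfree h)).1⟩,
    fun ⟨lev, h⟩ => ⟨e, spog_free D hH S hbig hsum h⟩⟩,
    fun h => ⟨fun eA hF => free_exp hA hchi hF, fun lev hS => ?_⟩⟩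
  obtain ⟨_, φ₀, hφ₀, h0⟩ := free_phi D hH S hR hbig (hfree h)
  obtain ⟨θ, φ, f, α, ⟨h1, h2, h3, h4, h5, -⟩, hα⟩ := hS
  have hD := spog_log D hH S hbig h1 h3
  obtain ⟨c, g, hcg⟩ := h5 φ₀ hφ₀
  exact S.level h0 (((D.sub (Finset.erase_subset H A)).inD_iff _).1 h2) h4 θ
    (fun j => ((D.log_split hH _).1 (hD j)).2) c g hcg

end ArrPOG
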